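/- Let p₁ < … < p_d be distinct primes and α = (log p₁, …, log p_d). Then there exist constants c > 0 and κ > 0, depending only on p₁, …, p_d, such that for every nonzero integer vector m = (m₁, …, m_d) ∈ ℤ^d \ {0}, the distance from m·α = ∑_{j=1}^d m_j log p_j to the nearest integer satisfies ‖m·α‖ ≥ c / (max_j |m_j|)^κ. -/

import Mathlib

open Finset

namespace BakerFeldman

section

open Polynomial

/-- An exponential polynomial over a field of characteristic zero with as many initial zeros as it
has terms vanishes identically. -/
theorem exp_poly_eq_zero {κ : Type*} [Fintype κ] [DecidableEq κ] (N : ℕ) (A : κ → ℂ)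
    (hA : Function.Injective A) (hA0 : ∀ i, A i ≠ 0) (D : κ → ℕ) (hD : ∑ i, D i = N)
    (Q : κ → ℂ[X]) (hQ : ∀ i, (Q i).degree < D i)
    (h : ∀ x : ℕ, x < N → ∑ i, (Q i).eval (x : ℂ) * A i ^ x = 0) : ∀ i, Q i = 0 := by
  induction N generalizing D Q with
  | zero =>
    intro i
    have h0 : D i = 0 := by simpa using Finset.sum_eq_zero_iff.1 hD i (mem_univ i)
    have := hQ i
    rw [h0, Nat.cast_zero] at this
    exact degree_eq_bot.1 (Nat.WithBot.lt_zero_iff.1 this)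
  | succ N ih =>
    obtain ⟨i₀, hi₀⟩ : ∃ i, D i ≠ 0 := by
      by_contra! hc
      simp [hc] at hD
    set Q' : κ → ℂ[X] := fun j => C (A j) * taylor 1 (Q j) - C (A i₀) * Q j with hQ'
    have hsum : ∑ i, Function.update D i₀ (D i₀ - 1) i = N := by
      have h1 := Finset.add_sum_erase univ D (mem_univ i₀)
      rw [Finset.sum_update_of_mem (mem_univ i₀)]
      rw [Finset.sdiff_singleton_eq_erase]
      omega
    have hdeg : ∀ j, (Q' j).degree < (Function.update D i₀ (D i₀ - 1) j : ℕ) := by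
      intro j
      by_cases hj : j = i₀
      · subst hj
        rw [Function.update_self]
        by_cases hz : Q j = 0
        · simp [hQ', hz]
        · have h1 : (taylor 1 (Q j) - Q j).degree < (taylor 1 (Q j)).degree :=
            degree_sub_lt_left (degree_taylor _ _) (by simpa using hz) (leadingCoeff_taylor _ _)
          have h2 : Q' j = C (A j) * (taylor 1 (Q j) - Q j) := by simp [hQ', mul_sub]
          rw [h2, degree_C_mul (hA0 j)]
          rw [degree_taylor] at h1
          have h3 := hQ j
          by_cases hz' : taylor 1 (Q j) - Q j = 0
          · simp [hz']
          rw [degree_eq_natDegree hz, degree_eq_natDegree hz'] at h1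
          rw [degree_eq_natDegree hz] at h3
          rw [degree_eq_natDegree hz']
          norm_cast at h1 h3 ⊢
          omega
      · rw [Function.update_of_ne hj]
        refine (degree_sub_le _ _).trans_lt (max_lt ?_ ?_)
        · rw [degree_C_mul (hA0 j), degree_taylor]; exact hQ j
        · rw [degree_C_mul (hA0 i₀)]; exact hQ j
    have hz := ih _ hsum Q' hdeg (by
      intro x hx
      have h1 := h (x + 1) (by omega)
      have h2 := h x (by omega)
      have : ∑ i, (Q' i).eval (x : ℂ) * A i ^ x =
          (∑ i, (Q i).eval ((x + 1 : ℕ) : ℂ) * A i ^ (x + 1))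
            - A i₀ * ∑ i, (Q i).eval (x : ℂ) * A i ^ x := by
        rw [Finset.mul_sum, ← Finset.sum_sub_distrib]
        refine Finset.sum_congr rfl fun i _ => ?_
        simp only [hQ', eval_sub, eval_mul, eval_C, taylor_eval]
        push_cast
        ring
      rw [this, h1, h2]; simp)
    have hne : ∀ j, j ≠ i₀ → Q j = 0 := by
      intro j hj
      by_contra hz'
      have h1 := sub_eq_zero.1 (hz j)
      have h2 := congrArg leadingCoeff h1
      rw [leadingCoeff_mul, leadingCoeff_mul, leadingCoeff_taylor, leadingCoeff_C,
        leadingCoeff_C] at h2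
      exact hj (hA (mul_right_cancel₀ (leadingCoeff_ne_zero.2 hz') h2))
    have hper : ∀ x : ℂ, (Q i₀).eval (x + 1) = (Q i₀).eval x := by
      intro x
      have h1 := congrArg (eval x) (sub_eq_zero.1 (hz i₀))
      simp only [eval_mul, eval_C, taylor_eval] at h1
      exact mul_left_cancel₀ (hA0 i₀) h1
    have h0 : (Q i₀).eval 0 = 0 := by
      have := h 0 (by omega)
      rw [Finset.sum_eq_single i₀ (fun j _ hj => by simp [hne j hj]) (by simp)] at this
      simpa using this
    have hall : ∀ x : ℕ, (Q i₀).eval (x : ℂ) = 0 := by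
      intro x
      induction x with
      | zero => simpa using h0
      | succ x ihx => push_cast; rw [hper, ihx]
    intro j
    by_cases hj : j = i₀
    · subst hj
      refine eq_zero_of_infinite_isRoot _ ?_
      refine (Set.infinite_range_of_injective (Nat.cast_injective (R := ℂ))).mono ?_
      rintro _ ⟨x, rfl⟩
      exact hall x
    · exact hne j hj

end

section

open Polynomial

/-- The binomial coefficient polynomial `X (X - 1) ⋯ (X - v + 1) / v!`. -/
noncomputable def binomPoly (v : ℕ) : ℂ[X] :=
  C ((v.factorial : ℂ)⁻¹) * ∏ j ∈ range v, (X - C (j : ℂ))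

theorem degree_binomPoly (v : ℕ) : (binomPoly v).degree = v := by
  rw [binomPoly, degree_C_mul (by simp [Nat.factorial_ne_zero]), degree_prod]
  simp [-map_natCast, degree_X_sub_C]

theorem binomPoly_comp_add_one (v : ℕ) :
    (binomPoly (v + 1)).comp (X + 1) = binomPoly (v + 1) + binomPoly v := by
  have h1 : (∏ j ∈ range (v + 1), (X - C (j : ℂ))).comp (X + 1) =
      (X + 1) * ∏ j ∈ range v, (X - C (j : ℂ)) := by
    rw [Polynomial.prod_comp, Finset.prod_range_succ']
    simp [mul_comm]
  have h2 : (C (((v + 1).factorial : ℂ)⁻¹) : ℂ[X]) * ((v : ℂ[X]) + 1) =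
      C ((v.factorial : ℂ)⁻¹) := by
    have : ((v : ℂ[X]) + 1) = C ((v : ℂ) + 1) := by simp
    rw [this, ← C_mul, Nat.factorial_succ]
    congr 1
    have : (v : ℂ) + 1 ≠ 0 := by exact_mod_cast Nat.succ_ne_zero v
    have := Nat.factorial_ne_zero v
    push_cast
    field_simp
  rw [binomPoly, mul_comp, C_comp, h1, binomPoly, Finset.prod_range_succ, ← h2]
  simp only [map_natCast]
  ring

/-- Polynomials `P` over `ℂ` for which `P (l + ν X)` has integer coefficients for every natural
number `l`. -/
noncomputable def integralSubring (ν : ℤ) : Subring ℂ[X] :=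
  ⨅ l : ℕ, (Polynomial.mapRingHom (Int.castRingHom ℂ)).range.comap
    (compRingHom (C (ν : ℂ) * X + C (l : ℂ)))

theorem mem_integralSubring {ν : ℤ} {P : ℂ[X]} : P ∈ integralSubring ν ↔
    ∀ l : ℕ, ∃ p : ℤ[X], p.map (Int.castRingHom ℂ) = P.comp (C (ν : ℂ) * X + C (l : ℂ)) := by
  simp [integralSubring, Subring.mem_iInf]

theorem exists_int_eval_of_mem {ν : ℤ} {P : ℂ[X]} (hP : P ∈ integralSubring ν) (l : ℕ) :
    ∃ a : ℤ, P.eval (l : ℂ) = a := by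
  obtain ⟨p, hp⟩ := mem_integralSubring.1 hP l
  refine ⟨p.eval 0, ?_⟩
  have := congrArg (eval 0) hp
  simp only [eval_comp, eval_add, eval_mul, eval_C, eval_X, mul_zero, zero_add] at this
  rw [← this, show (0 : ℂ) = (Int.castRingHom ℂ) 0 by simp, eval_map_apply]
  simp

theorem binomPoly_comp_mem (ν : ℤ) (v : ℕ) (hν : ∀ j : ℕ, 1 ≤ j → j ≤ v → (j : ℤ) ∣ ν) :
    binomPoly v ∈ integralSubring ν := by
  rw [mem_integralSubring]
  intro l
  induction l generalizing v with
  | zero =>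
    cases v with
    | zero => exact ⟨1, by simp [binomPoly]⟩
    | succ v =>
      obtain ⟨m, hm⟩ := hν (v + 1) (by omega) le_rfl
      choose f hf using fun j : ℕ => fun (h : 1 ≤ j) (h' : j ≤ v + 1) => hν j h h'
      refine ⟨C m * X * ∏ j ∈ (range v).attach, (C (f (j.1 + 1) (by omega)
        (by have := mem_range.1 j.2; omega)) * X - 1), ?_⟩
      have h2 : (∏ j ∈ (range v).attach, (C (f (j.1 + 1) (by omega)
        (by have := mem_range.1 j.2; omega)) * X - 1)).map (Int.castRingHom ℂ) =
          C ((v.factorial : ℂ)⁻¹) * ∏ j ∈ range v, (C (ν : ℂ) * X - C ((j : ℂ) + 1)) := by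
        rw [Polynomial.map_prod]
        have : (C ((v.factorial : ℂ)⁻¹) : ℂ[X]) = ∏ j ∈ (range v).attach, C (((j.1 : ℂ) + 1)⁻¹) := by
          rw [Finset.prod_attach (range v) (fun j => (C (((j : ℂ) + 1)⁻¹) : ℂ[X])),
            ← Finset.prod_range_add_one_eq_factorial, ← map_prod]
          push_cast
          rw [Finset.prod_inv_distrib]
        rw [this, ← Finset.prod_attach (range v), ← Finset.prod_mul_distrib]
        refine Finset.prod_congr rfl fun j _ => ?_
        have hj := hf (j.1 + 1) (by omega) (by have := mem_range.1 j.2; omega)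
        set a := f (j.1 + 1) (by omega) (by have := mem_range.1 j.2; omega)
        have hne : (j.1 : ℂ) + 1 ≠ 0 := by exact_mod_cast Nat.succ_ne_zero j.1
        have h3 : ((j.1 : ℂ) + 1)⁻¹ * (ν : ℂ) = a := by
          rw [hj]; push_cast; field_simp
        rw [mul_sub, ← mul_assoc, ← C_mul, ← C_mul, h3, inv_mul_cancel₀ hne]
        simp
      rw [Polynomial.map_mul, h2, binomPoly, mul_comp, C_comp, Polynomial.prod_comp, Finset.prod_range_succ']
      have hne : (v : ℂ) + 1 ≠ 0 := by exact_mod_cast Nat.succ_ne_zero v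
      have h4 : (m : ℂ) * (v.factorial : ℂ)⁻¹ = ((v + 1).factorial : ℂ)⁻¹ * ν := by
        rw [hm, Nat.factorial_succ]
        have := Nat.factorial_ne_zero v
        push_cast; field_simp
      have h5 := congrArg (C : ℂ → ℂ[X]) h4
      simp only [C_mul] at h5
      have h6 : (C m : ℤ[X]).map (Int.castRingHom ℂ) = C (m : ℂ) := by rw [Polynomial.map_C]; rfl
      rw [Polynomial.map_mul, h6]
      simp only [map_X, sub_comp, X_comp, C_comp, Nat.cast_zero,
        Nat.cast_add, Nat.cast_one, C_0, add_zero, sub_zero]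
      linear_combination (X * ∏ j ∈ range v, (C (ν : ℂ) * X - C ((j : ℂ) + 1))) * h5
  | succ l ih =>
    have hc : (C (ν : ℂ) * X + C ((l + 1 : ℕ) : ℂ) : ℂ[X]) =
        (X + 1 : ℂ[X]).comp (C (ν : ℂ) * X + C (l : ℂ)) := by
      simp [add_assoc]
    cases v with
    | zero => exact ⟨1, by simp [binomPoly]⟩
    | succ v =>
      obtain ⟨p, hp⟩ := ih (v + 1) hν
      obtain ⟨q, hq⟩ := ih v fun j h h' => hν j h (by omega)
      refine ⟨p + q, ?_⟩
      rw [hc, ← comp_assoc, binomPoly_comp_add_one, add_comp, Polynomial.map_add, hp, hq]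

/-- The twisted derivation `P ↦ ν B P' - ν m P`. -/
noncomputable def twist (ν B m : ℤ) (P : ℂ[X]) : ℂ[X] :=
  C ((ν * B : ℤ) : ℂ) * derivative P - C ((ν * m : ℤ) : ℂ) * P

theorem twist_mem {ν B m : ℤ} {P : ℂ[X]} (hP : P ∈ integralSubring ν) :
    twist ν B m P ∈ integralSubring ν := by
  rw [mem_integralSubring] at hP ⊢
  intro l
  obtain ⟨p, hp⟩ := hP l
  refine ⟨C B * derivative p - C (ν * m) * p, ?_⟩
  have h := congrArg derivative hp
  rw [derivative_map, derivative_comp] at h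
  rw [Polynomial.map_sub, Polynomial.map_mul, Polynomial.map_mul, hp, h]
  simp [twist]
  ring

theorem twist_iterate_mem {ν B m : ℤ} {P : ℂ[X]} (hP : P ∈ integralSubring ν) (σ : ℕ) :
    (twist ν B m)^[σ] P ∈ integralSubring ν := by
  induction σ with
  | zero => exact hP
  | succ σ ih => rw [Function.iterate_succ_apply']; exact twist_mem ih

/-- Feldman's polynomials: the `a`-th one has degree `a`. -/
noncomputable def feldman (h a : ℕ) : ℂ[X] := binomPoly h ^ (a / h) * binomPoly (a % h)

theorem degree_feldman (h a : ℕ) : (feldman h a).degree = a := by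
  rw [feldman, degree_mul, degree_pow, degree_binomPoly, degree_binomPoly]
  have := Nat.div_add_mod a h
  rw [nsmul_eq_mul, ← Nat.cast_mul, ← Nat.cast_add, mul_comm, this]

theorem feldman_mem (ν : ℤ) (h a : ℕ) (hh : 0 < h)
    (hν : ∀ j : ℕ, 1 ≤ j → j ≤ h → (j : ℤ) ∣ ν) : feldman h a ∈ integralSubring ν :=
  mul_mem (pow_mem (binomPoly_comp_mem ν h hν) _)
    (binomPoly_comp_mem ν _ fun j h1 h2 => hν j h1 (h2.trans (Nat.mod_lt a hh).le))

theorem feldman_sum_eq_zero {h N : ℕ} {c : Fin N → ℂ}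
    (hc : ∑ a, C (c a) * feldman h a = 0) : ∀ a, c a = 0 := by
  let S : Polynomial.Sequence ℂ := ⟨feldman h, degree_feldman h⟩
  have hS : LinearIndependent ℂ (fun a : Fin N => S (a : ℕ)) :=
    S.linearIndependent.comp _ Fin.val_injective
  rw [Fintype.linearIndependent_iff] at hS
  refine hS c ?_
  simpa [smul_eq_C_mul] using hc

theorem norm_binomPoly_eval_le {h v : ℕ} (hv : v ≤ h) {Y : ℝ} (hY : 1 ≤ Y) {z : ℂ}
    (hz : ‖z‖ + h ≤ h * Y) : ‖(binomPoly v).eval z‖ ≤ (Real.exp 1 * Y) ^ h := by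
  have h1 : ‖∏ j ∈ range v, (z - (j : ℂ))‖ ≤ (h * Y) ^ v := by
    rw [norm_prod]
    calc _ ≤ ∏ j ∈ range v, (h * Y : ℝ) := by
          refine Finset.prod_le_prod (fun _ _ => norm_nonneg _) fun j hj => ?_
          refine (norm_sub_le _ _).trans ?_
          have : (j : ℝ) ≤ h := by exact_mod_cast (mem_range.1 hj).le.trans hv
          simp only [Complex.norm_natCast]
          linarith
      _ = _ := by simp
  have h2 : (h : ℝ) ^ v / v.factorial ≤ Real.exp 1 ^ h := by
    rw [Real.exp_one_pow]
    exact Real.pow_div_factorial_le_exp _ (Nat.cast_nonneg _) _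
  calc _ = (v.factorial : ℝ)⁻¹ * ‖∏ j ∈ range v, (z - (j : ℂ))‖ := by
        simp [binomPoly, eval_prod]
    _ ≤ (v.factorial : ℝ)⁻¹ * (h * Y) ^ v := by gcongr
    _ = (h : ℝ) ^ v / v.factorial * Y ^ v := by rw [mul_pow]; ring
    _ ≤ Real.exp 1 ^ h * Y ^ h := by gcongr
    _ = _ := by rw [mul_pow]

theorem norm_feldman_eval_le {h a L : ℕ} (ha : a < h * L) {Y : ℝ} (hY : 1 ≤ Y) {z : ℂ}
    (hz : ‖z‖ + h ≤ h * Y) : ‖(feldman h a).eval z‖ ≤ (Real.exp 1 * Y) ^ (h * L) := by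
  have hh : 0 < h := Nat.pos_of_ne_zero (by rintro rfl; simp at ha)
  have hE : 1 ≤ Real.exp 1 * Y := one_le_mul_of_one_le_of_one_le (by simp) hY
  have hd : a / h + 1 ≤ L := Nat.div_lt_of_lt_mul ha
  calc _ = ‖(binomPoly h).eval z‖ ^ (a / h) * ‖(binomPoly (a % h)).eval z‖ := by
        simp [feldman]
    _ ≤ ((Real.exp 1 * Y) ^ h) ^ (a / h) * (Real.exp 1 * Y) ^ h := by
        gcongr
        · exact norm_binomPoly_eval_le le_rfl hY hz
        · exact norm_binomPoly_eval_le (Nat.mod_lt a hh).le hY hz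
    _ = ((Real.exp 1 * Y) ^ h) ^ (a / h + 1) := by rw [pow_succ]
    _ ≤ ((Real.exp 1 * Y) ^ h) ^ L := pow_le_pow_right₀ (one_le_pow₀ hE) hd
    _ = _ := by rw [pow_mul]

theorem norm_derivative_eval_le {P : ℂ[X]} {ρ G : ℝ} (hP : ∀ z : ℂ, ‖z‖ ≤ ρ + 1 → ‖P.eval z‖ ≤ G)
    {z : ℂ} (hz : ‖z‖ ≤ ρ) : ‖(derivative P).eval z‖ ≤ G := by
  have := Complex.norm_deriv_le_of_forall_mem_sphere_norm_le (c := z) (R := 1) (C := G)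
    (f := fun w => P.eval w) one_pos P.differentiable.diffContOnCl (by
      intro w hw
      refine hP w ?_
      have h1 : ‖w - z‖ = 1 := by simpa [dist_eq_norm] using hw
      have h2 : ‖w‖ ≤ ‖w - z‖ + ‖z‖ := by simpa using norm_add_le (w - z) z
      linarith)
  simpa using this

theorem norm_twist_iterate_eval_le {ν B m : ℤ} {P : ℂ[X]} {G W : ℝ} (σ : ℕ)
    (hW : |(ν * B : ℝ)| + |(ν * m : ℝ)| ≤ W) {ρ : ℝ}
    (hP : ∀ z : ℂ, ‖z‖ ≤ ρ + σ → ‖P.eval z‖ ≤ G) {z : ℂ} (hz : ‖z‖ ≤ ρ) :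
    ‖((twist ν B m)^[σ] P).eval z‖ ≤ W ^ σ * G := by
  induction σ generalizing P G with
  | zero => simpa using hP z (by simpa using hz)
  | succ σ ih =>
    rw [Function.iterate_succ_apply]
    have := ih (P := twist ν B m P) (G := W * G) (by
      intro z hz
      have h1 : ‖(derivative P).eval z‖ ≤ G :=
        norm_derivative_eval_le (ρ := ρ + σ) (fun w hw => hP w (by push_cast; linarith)) hz
      have h2 : ‖P.eval z‖ ≤ G := hP z (by push_cast; linarith)
      have hG : 0 ≤ G := (norm_nonneg _).trans h2
      calc ‖(twist ν B m P).eval z‖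
          ≤ ‖((ν * B : ℤ) : ℂ)‖ * ‖(derivative P).eval z‖ + ‖((ν * m : ℤ) : ℂ)‖ * ‖P.eval z‖ := by
            simp only [twist, eval_sub, eval_mul, eval_C]
            refine (norm_sub_le _ _).trans ?_
            rw [norm_mul, norm_mul]
        _ ≤ |(ν * B : ℝ)| * G + |(ν * m : ℝ)| * G := by
            simp only [Complex.norm_intCast]
            push_cast
            gcongr
        _ ≤ W * G := by rw [← add_mul]; gcongr)
    rwa [pow_succ, mul_assoc]

end

section

open Polynomial

theorem exists_entire_factor {f : ℂ → ℂ} (hf : Differentiable ℂ f) (x : ℂ) (T : ℕ)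
    (h : (T : ℕ∞) ≤ analyticOrderAt f x) :
    ∃ g : ℂ → ℂ, Differentiable ℂ g ∧ ∀ z, f z = (z - x) ^ T * g z := by
  induction T generalizing f with
  | zero => exact ⟨f, hf, by simp⟩
  | succ T ih =>
    have hfa : AnalyticAt ℂ f x := hf.analyticAt x
    have hfx : f x = 0 := by
      apply apply_eq_zero_of_analyticOrderAt_ne_zero
      intro h0
      rw [h0] at h
      simp at h
    have hd : Differentiable ℂ (dslope f x) := by
      rw [← differentiableOn_univ]
      exact (Complex.differentiableOn_dslope Filter.univ_mem).2 hf.differentiableOn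
    have hfac : ∀ z, f z = (z - x) * dslope f x z := by
      intro z
      have := sub_smul_dslope f x z
      rw [hfx, sub_zero, smul_eq_mul] at this
      exact this.symm
    have hord : analyticOrderAt f x = 1 + analyticOrderAt (dslope f x) x := by
      have h1 : f = (fun z => z - x) * dslope f x := funext hfac
      have h2 : analyticOrderAt (fun z : ℂ => z - x) x = 1 := by
        refine AnalyticAt.analyticOrderAt_eq_one_of_zero_deriv_ne_zero (by fun_prop) (by simp) ?_
        simp
      conv_lhs => rw [h1]
      rw [analyticOrderAt_mul (by fun_prop) (hd.analyticAt x), h2]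
    rw [hord, Nat.cast_succ, add_comm (T : ℕ∞) 1] at h
    obtain ⟨g, hg, hgf⟩ := ih hd
      ((ENat.add_le_add_iff_left (by simp : (1 : ℕ∞) ≠ ⊤)).1 h)
    refine ⟨g, hg, fun z => ?_⟩
    rw [hfac, hgf]; ring

theorem exists_entire_factor_prod {f : ℂ → ℂ} (hf : Differentiable ℂ f) (T : ℕ) (s : Finset ℂ)
    (h : ∀ x ∈ s, (T : ℕ∞) ≤ analyticOrderAt f x) :
    ∃ g : ℂ → ℂ, Differentiable ℂ g ∧ ∀ z, f z = (∏ x ∈ s, (z - x)) ^ T * g z := by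
  classical
  induction s using Finset.induction_on with
  | empty => exact ⟨f, hf, by simp⟩
  | insert x s hx ih =>
    obtain ⟨g, hg, hfg⟩ := ih fun y hy => h y (mem_insert_of_mem hy)
    have hord : analyticOrderAt f x = analyticOrderAt g x := by
      have h1 : f = (fun z => (∏ y ∈ s, (z - y)) ^ T) * g := funext hfg
      have h2 : analyticOrderAt (fun z => (∏ y ∈ s, (z - y)) ^ T) x = 0 := by
        rw [analyticOrderAt_eq_zero]
        right
        refine pow_ne_zero _ (prod_ne_zero_iff.2 fun y hy => sub_ne_zero.2 ?_)
        rintro rfl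
        exact hx hy
      rw [h1, analyticOrderAt_mul (by fun_prop) (hg.analyticAt x), h2, zero_add]
    obtain ⟨g', hg', hgg'⟩ := exists_entire_factor hg x T (hord ▸ h x (mem_insert_self _ _))
    refine ⟨g', hg', fun z => ?_⟩
    rw [hfg, hgg', prod_insert hx, mul_pow]
    ring

/-- Polynomials with constant term `1` whose coefficients are bounded by powers of `N`. -/
def CoeffBound (N : ℝ) (p : ℂ[X]) : Prop :=
  p.coeff 0 = 1 ∧ ∀ j, ‖p.coeff j‖ ≤ N ^ j

theorem CoeffBound.mul {N M : ℝ} (hN : 0 ≤ N) (hM : 0 ≤ M) {p q : ℂ[X]} (hp : CoeffBound N p)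
    (hq : CoeffBound M q) : CoeffBound (N + M) (p * q) := by
  refine ⟨by simp [mul_coeff_zero, hp.1, hq.1], fun j => ?_⟩
  rw [coeff_mul, (Commute.all N M).add_pow']
  refine (norm_sum_le _ _).trans (Finset.sum_le_sum fun x hx => ?_)
  rw [norm_mul, nsmul_eq_mul]
  have h1 : (1 : ℝ) ≤ (j.choose x.1 : ℕ) := by
    exact_mod_cast Nat.choose_pos (by have := mem_antidiagonal.1 hx; omega)
  calc _ ≤ N ^ x.1 * M ^ x.2 := by gcongr; exacts [hp.2 _, hq.2 _]
    _ ≤ _ := le_mul_of_one_le_left (by positivity) h1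

theorem coeffBound_one : CoeffBound 0 1 := by
  refine ⟨by simp, fun j => ?_⟩
  cases j <;> simp [coeff_one]

theorem CoeffBound.pow {N : ℝ} (hN : 0 ≤ N) {p : ℂ[X]} (hp : CoeffBound N p) (T : ℕ) :
    CoeffBound (N * T) (p ^ T) := by
  induction T with
  | zero => simpa using coeffBound_one
  | succ T ih =>
    rw [pow_succ]
    have := ih.mul (by positivity) hN hp
    convert this using 1
    push_cast; ring

theorem CoeffBound.prod {α : Type*} (s : Finset α) {p : α → ℂ[X]}
    (hp : ∀ i ∈ s, CoeffBound 1 (p i)) : CoeffBound s.card (∏ i ∈ s, p i) := by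
  classical
  induction s using Finset.induction_on with
  | empty => simpa using coeffBound_one
  | insert x s hx ih =>
    rw [prod_insert hx, card_insert_of_notMem hx]
    have := (hp x (mem_insert_self _ _)).mul zero_le_one (Nat.cast_nonneg s.card)
      (ih fun i hi => hp i (mem_insert_of_mem hi))
    convert this using 1
    push_cast; ring

theorem CoeffBound.mono {N M : ℝ} (hN : 0 ≤ N) (hNM : N ≤ M) {p : ℂ[X]} (hp : CoeffBound N p) :
    CoeffBound M p :=
  ⟨hp.1, fun j => (hp.2 j).trans (pow_le_pow_left₀ hN hNM j)⟩

theorem coeffBound_one_add_C_mul_X {c : ℂ} (hc : ‖c‖ ≤ 1) : CoeffBound 1 (1 + C c * X) := by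
  refine ⟨by simp, fun j => ?_⟩
  rcases j with _ | _ | j
  · simp
  · simpa [coeff_one] using hc
  · simp [coeff_one]

/-- Division of truncated power series, with a bound for the coefficients of the quotient. -/
theorem exists_truncated_quotient {E : ℝ} (hE : 1 ≤ E) {a : ℂ[X]} (ha : CoeffBound E a)
    (t : ℕ → ℂ) {δ : ℝ} (T : ℕ) (ht : ∀ m < T, ‖t m‖ ≤ δ) :
    ∃ S : ℂ[X], S.natDegree < T + 1 ∧ (∀ m < T, (a * S).coeff m = t m) ∧
      ∀ m < T, ‖S.coeff m‖ ≤ δ * (2 * E) ^ m := by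
  set s : PowerSeries ℂ := (a : PowerSeries ℂ)⁻¹ * PowerSeries.mk t with hs
  have hconst : PowerSeries.constantCoeff (a : PowerSeries ℂ) ≠ 0 := by
    simp [ha.1]
  have has : (a : PowerSeries ℂ) * s = PowerSeries.mk t := by
    rw [hs, ← mul_assoc, PowerSeries.mul_inv_cancel _ hconst, one_mul]
  have hcoef : ∀ m, ∑ x ∈ antidiagonal m, a.coeff x.1 * PowerSeries.coeff x.2 s = t m := by
    intro m
    have := congrArg (PowerSeries.coeff m) has
    rw [PowerSeries.coeff_mul, PowerSeries.coeff_mk] at this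
    simpa using this
  refine ⟨PowerSeries.trunc T s, ?_, ?_, ?_⟩
  · rcases T with _ | T
    · simp
    · exact (PowerSeries.natDegree_trunc_lt s T).trans (by omega)
  · intro m hm
    rw [coeff_mul, ← hcoef m]
    refine Finset.sum_congr rfl fun x hx => ?_
    rw [PowerSeries.coeff_trunc, if_pos]
    have := mem_antidiagonal.1 hx
    omega
  · intro m hm
    rw [PowerSeries.coeff_trunc, if_pos hm]
    induction m using Nat.strong_induction_on with
    | _ m ih =>
      have hδ : 0 ≤ δ := (norm_nonneg _).trans (ht m hm)
      have h1 := hcoef m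
      rw [Finset.Nat.sum_antidiagonal_eq_sum_range_succ
        (fun i j => a.coeff i * PowerSeries.coeff j s), Finset.sum_range_succ', ha.1, one_mul,
        Nat.sub_zero] at h1
      have h2 : PowerSeries.coeff m s =
          t m - ∑ k ∈ range m, a.coeff (k + 1) * PowerSeries.coeff (m - (k + 1)) s := by
        rw [← h1]; ring
      rw [h2]
      have h3 : ∀ k ∈ range m, ‖a.coeff (k + 1) * PowerSeries.coeff (m - (k + 1)) s‖ ≤
          δ * E ^ m * 2 ^ (m - 1 - k) := by
        intro k hk
        have hk' := mem_range.1 hk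
        rw [norm_mul]
        calc _ ≤ E ^ (k + 1) * (δ * (2 * E) ^ (m - (k + 1))) := by
              gcongr
              · exact ha.2 _
              · exact ih _ (by omega) (by omega)
          _ = δ * (E ^ (k + 1) * E ^ (m - (k + 1))) * 2 ^ (m - (k + 1)) := by
              rw [mul_pow]; ring
          _ = _ := by
              rw [← pow_add, Nat.add_sub_cancel' (by omega), show m - (k + 1) = m - 1 - k by omega]
      have h4 : ∑ k ∈ range m, (2 : ℝ) ^ (m - 1 - k) = 2 ^ m - 1 := by
        rw [Finset.sum_range_reflect (fun k => (2 : ℝ) ^ k) m, geom_sum_eq (by norm_num)]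
        norm_num
      have hEm : 1 ≤ E ^ m := one_le_pow₀ hE
      calc _ ≤ δ + ∑ k ∈ range m, δ * E ^ m * 2 ^ (m - 1 - k) :=
            (norm_sub_le _ _).trans (add_le_add (ht m hm)
              ((norm_sum_le _ _).trans (Finset.sum_le_sum h3)))
        _ = δ + δ * E ^ m * (2 ^ m - 1) := by rw [← Finset.mul_sum, h4]
        _ ≤ δ * E ^ m + δ * E ^ m * (2 ^ m - 1) := by
            gcongr
            exact le_mul_of_one_le_right hδ hEm
        _ = _ := by rw [mul_pow]; ring

theorem iteratedDeriv_polynomial (P : ℂ[X]) (m : ℕ) (x : ℂ) :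
    iteratedDeriv m (fun z => P.eval z) x = m.factorial * (taylor x P).coeff m := by
  have h1 : ∀ m, iteratedDeriv m (fun z => P.eval z) = fun z => (derivative^[m] P).eval z := by
    intro m
    induction m with
    | zero => simp
    | succ m ih =>
      rw [iteratedDeriv_succ, ih]
      funext z
      rw [Polynomial.deriv, Function.iterate_succ_apply']
  rw [h1, taylor_coeff]
  have h2 := congrFun (factorial_smul_hasseDeriv (R := ℂ) m) P
  rw [← h2]
  simp [nsmul_eq_mul]

/-- The Lagrange basis polynomials on the nodes `0, …, R - 1`. -/
noncomputable def lagrangeBasis (R l : ℕ) : ℂ[X] :=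
  ∏ j ∈ (range R).erase l, (C (((l : ℂ) - j)⁻¹) * (X - C (j : ℂ)))

theorem X_dvd_taylor_lagrangeBasis {R l l' : ℕ} (hl : l < R) (h : l ≠ l') :
    X ∣ taylor (l : ℂ) (lagrangeBasis R l') := by
  rw [X_dvd_iff, taylor_coeff_zero, lagrangeBasis, eval_prod]
  refine Finset.prod_eq_zero (i := l) (by simp [hl, h]) ?_
  simp

theorem coeffBound_taylor_lagrangeBasis {R l : ℕ} :
    CoeffBound R (taylor (l : ℂ) (lagrangeBasis R l)) := by
  have h1 : taylor (l : ℂ) (lagrangeBasis R l) =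
      ∏ j ∈ (range R).erase l, (1 + C (((l : ℂ) - j)⁻¹) * X) := by
    rw [taylor_apply, lagrangeBasis, Polynomial.prod_comp]
    refine Finset.prod_congr rfl fun j hj => ?_
    have hne : (l : ℂ) - j ≠ 0 := by
      rw [sub_ne_zero]
      exact_mod_cast (ne_of_mem_erase hj).symm
    have h2 : (C (((l : ℂ) - j)⁻¹) : ℂ[X]) * (C (l : ℂ) - C (j : ℂ)) = 1 := by
      rw [← C_sub, ← C_mul, inv_mul_cancel₀ hne, C_1]
    simp only [mul_comp, sub_comp, X_comp, C_comp]
    linear_combination h2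
  rw [h1]
  refine (CoeffBound.prod ((range R).erase l) fun j hj => coeffBound_one_add_C_mul_X ?_).mono
    (by positivity) ?_
  · have h1 : (1 : ℝ) ≤ ‖(l : ℂ) - j‖ := by
      have h2 : (l : ℤ) - j ≠ 0 := by
        rw [sub_ne_zero]; exact_mod_cast (ne_of_mem_erase hj).symm
      have h3 : (1 : ℝ) ≤ |((l - j : ℤ) : ℝ)| := by exact_mod_cast Int.one_le_abs h2
      rw [← Complex.norm_intCast] at h3
      simpa using h3
    rw [norm_inv]
    exact inv_le_one_of_one_le₀ h1
  · exact_mod_cast (card_le_card (erase_subset _ _)).trans (by simp)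

theorem prod_erase_abs_sub (l m : ℕ) :
    ∏ j ∈ (range (l + 1 + m)).erase l, |(l : ℝ) - j| = l.factorial * m.factorial := by
  have h1 : ∏ j ∈ (range (l + 1 + m)).erase l, |(l : ℝ) - j| =
      ∏ j ∈ range (l + 1 + m), if j = l then 1 else |(l : ℝ) - j| := by
    rw [← Finset.mul_prod_erase (range (l + 1 + m)) _ (mem_range.2 (by omega : l < l + 1 + m))]
    rw [if_pos rfl, one_mul]
    exact Finset.prod_congr rfl fun j hj => by rw [if_neg (ne_of_mem_erase hj)]
  rw [h1, Finset.prod_range_add, Finset.prod_range_succ, if_pos rfl, mul_one]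
  congr 1
  · rw [← Finset.prod_range_add_one_eq_factorial, ← Finset.prod_range_reflect]
    push_cast
    refine Finset.prod_congr rfl fun j hj => ?_
    have hj := mem_range.1 hj
    rw [if_neg (by omega), abs_of_nonneg]
    · rw [Nat.cast_sub (by omega), Nat.cast_sub (by omega)]
      push_cast; ring
    · rw [sub_nonneg]
      exact_mod_cast (by omega)
  · rw [← Finset.prod_range_add_one_eq_factorial]
    push_cast
    refine Finset.prod_congr rfl fun j hj => ?_
    rw [if_neg (by omega)]
    have : (l : ℝ) - (l + 1 + j) = -(j + 1) := by ring
    rw [this, abs_neg, abs_of_nonneg (by positivity)]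

theorem norm_lagrangeBasis_le {R l : ℕ} (hl : l < R) {Y : ℝ} (hY : 1 ≤ Y) {z : ℂ}
    (hz : ‖z‖ + R ≤ R * Y) : ‖(lagrangeBasis R l).eval z‖ ≤ (2 * Real.exp 1 * Y) ^ R := by
  obtain ⟨m, rfl⟩ : ∃ m, R = l + 1 + m := ⟨R - (l + 1), by omega⟩
  set R := l + 1 + m with hR
  have h1 : ‖(lagrangeBasis R l).eval z‖ =
      (∏ j ∈ (range R).erase l, ‖z - j‖) / (l.factorial * m.factorial) := by
    rw [← prod_erase_abs_sub, ← Finset.prod_div_distrib, lagrangeBasis, eval_prod, norm_prod]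
    refine Finset.prod_congr rfl fun j _ => ?_
    have : |(l : ℝ) - j| = ‖(l : ℂ) - j‖ := by
      have := Complex.norm_real ((l : ℝ) - j)
      rw [Real.norm_eq_abs] at this
      rw [← this]; push_cast; rfl
    rw [this]
    simp [div_eq_inv_mul]
  have h2 : ∏ j ∈ (range R).erase l, ‖z - j‖ ≤ (R * Y) ^ (l + m) := by
    calc _ ≤ ∏ j ∈ (range R).erase l, (R * Y : ℝ) := by
          refine Finset.prod_le_prod (fun _ _ => norm_nonneg _) fun j hj => ?_
          refine (norm_sub_le _ _).trans ?_
          have : (j : ℝ) ≤ R := by exact_mod_cast (mem_range.1 (mem_of_mem_erase hj)).le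
          simp only [Complex.norm_natCast]
          linarith
      _ = _ := by
          rw [Finset.prod_const, card_erase_of_mem (mem_range.2 hl), card_range,
            show R - 1 = l + m by omega]
  have h3 : ((l + m).factorial : ℝ) ≤ 2 ^ (l + m) * (l.factorial * m.factorial) := by
    have h4 := Nat.add_choose_mul_factorial_mul_factorial l m
    have h5 : (l + m).choose m ≤ 2 ^ (l + m) := Nat.choose_le_two_pow _ _
    rw [← h4, mul_assoc]
    exact_mod_cast Nat.mul_le_mul_right _ h5
  have h6 : (R : ℝ) ^ (l + m) / (l + m).factorial ≤ Real.exp 1 ^ R := by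
    rw [Real.exp_one_pow]
    exact Real.pow_div_factorial_le_exp _ (Nat.cast_nonneg _) _
  have hf : (0 : ℝ) < l.factorial * m.factorial := by positivity
  have hf' : (0 : ℝ) < (l + m).factorial := by positivity
  rw [h1]
  calc _ ≤ (R * Y) ^ (l + m) / (l.factorial * m.factorial : ℝ) := by gcongr
    _ = (R * Y) ^ (l + m) * (1 / (l.factorial * m.factorial)) := by ring
    _ ≤ (R * Y) ^ (l + m) * (2 ^ (l + m) / (l + m).factorial) := by
        refine mul_le_mul_of_nonneg_left ?_ (by positivity)
        rw [div_le_div_iff₀ hf hf', one_mul]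
        exact h3
    _ = 2 ^ (l + m) * (R ^ (l + m) / (l + m).factorial) * Y ^ (l + m) := by
        rw [mul_pow]; ring
    _ ≤ 2 ^ R * Real.exp 1 ^ R * Y ^ R :=
        mul_le_mul (mul_le_mul (pow_le_pow_right₀ (by norm_num) (by omega)) h6 (by positivity)
          (by positivity)) (pow_le_pow_right₀ hY (by omega)) (by positivity) (by positivity)
    _ = _ := by rw [mul_pow, mul_pow]

/-- Hermite interpolation of small data on `0, …, R - 1` by a small polynomial. -/
theorem exists_hermite_interpolation {f : ℂ → ℂ} (hf : Differentiable ℂ f) {R T : ℕ}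
    (hR : 1 ≤ R) (hT : 1 ≤ T) {δ : ℝ}
    (hδ : ∀ l < R, ∀ m < T, ‖iteratedDeriv m f l‖ ≤ δ) {Y : ℝ} (hY : 1 ≤ Y) :
    ∃ Q : ℂ[X], (∀ l < R, (T : ℕ∞) ≤ analyticOrderAt (fun z => f z - Q.eval z) (l : ℂ)) ∧
      ∀ z : ℂ, ‖z‖ + R ≤ R * Y → ‖Q.eval z‖ ≤
        δ * (R * T * (2 * Real.exp 1 * Y) ^ (R * T) * (2 * (R * T) * (R * Y)) ^ T) := by
  have hE : (1 : ℝ) ≤ R * T := by exact_mod_cast Nat.one_le_iff_ne_zero.2 (by positivity)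
  have hδ0 : 0 ≤ δ := (norm_nonneg _).trans (hδ 0 (by omega) 0 (by omega))
  have hS : ∀ l : ℕ, ∃ S : ℂ[X], l < R → S.natDegree < T + 1 ∧
      (∀ m < T, ((taylor (l : ℂ) (lagrangeBasis R l)) ^ T * S).coeff m =
        iteratedDeriv m f l / m.factorial) ∧
      ∀ m < T, ‖S.coeff m‖ ≤ δ * (2 * (R * T)) ^ m := by
    intro l
    by_cases hl : l < R
    · obtain ⟨S, h⟩ := exists_truncated_quotient hE
        ((coeffBound_taylor_lagrangeBasis (R := R) (l := l)).pow (Nat.cast_nonneg _) T)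
        (fun m => iteratedDeriv m f l / m.factorial) (δ := δ) T (by
          intro m hm
          rw [norm_div, Complex.norm_natCast]
          refine (div_le_self (norm_nonneg _) ?_).trans (hδ l hl m hm)
          exact_mod_cast Nat.factorial_pos m)
      exact ⟨S, fun _ => h⟩
    · exact ⟨0, fun h => absurd h hl⟩
  choose S hS using hS
  set S' : ℕ → ℂ[X] := fun l => ∑ m ∈ range T, C ((S l).coeff m) * X ^ m with hS'
  have hS'c : ∀ l m, m < T → (S' l).coeff m = (S l).coeff m := by
    intro l m hm
    simp [hS', coeff_X_pow, hm]
  set Q : ℂ[X] := ∑ l ∈ range R, lagrangeBasis R l ^ T * taylor (-(l : ℂ)) (S' l) with hQ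
  refine ⟨Q, fun l hl => ?_, fun z hz => ?_⟩
  · have han : AnalyticAt ℂ (fun z => f z - Q.eval z) l := (hf.sub Q.differentiable).analyticAt _
    rw [natCast_le_analyticOrderAt_iff_iteratedDeriv_eq_zero han]
    intro i hi
    have hcoef : (taylor (l : ℂ) Q).coeff i = iteratedDeriv i f l / i.factorial := by
      rw [hQ, map_sum, finsetSum_coeff, Finset.sum_eq_single l]
      · rw [taylor_mul, taylor_pow, taylor_taylor, add_neg_cancel, taylor_zero,
          ← (hS l hl).2.1 i hi, coeff_mul, coeff_mul]
        refine Finset.sum_congr rfl fun x hx => ?_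
        rw [hS'c]
        have := mem_antidiagonal.1 hx
        omega
      · intro l' _ hne
        rw [taylor_mul, taylor_pow]
        obtain ⟨q, hq⟩ := X_dvd_taylor_lagrangeBasis hl hne.symm
        rw [hq, mul_pow, mul_assoc, coeff_X_pow_mul', if_neg (by omega)]
      · intro h
        exact absurd (mem_range.2 hl) h
    rw [iteratedDeriv_fun_sub (hf.contDiff.contDiffAt) Q.differentiable.contDiff.contDiffAt, iteratedDeriv_polynomial, hcoef]
    have : (i.factorial : ℂ) ≠ 0 := by exact_mod_cast Nat.factorial_ne_zero i
    field_simp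
    ring
  · have hRY : (1 : ℝ) ≤ R * Y := one_le_mul_of_one_le_of_one_le (by exact_mod_cast hR) hY
    have h1 : ∀ l ∈ range R, ‖(lagrangeBasis R l ^ T * taylor (-(l : ℂ)) (S' l)).eval z‖ ≤
        (2 * Real.exp 1 * Y) ^ (R * T) * (T * (δ * (2 * (R * T) * (R * Y)) ^ T)) := by
      intro l hl
      have hl := mem_range.1 hl
      rw [eval_mul, eval_pow, norm_mul, norm_pow, pow_mul]
      have hbase : (1 : ℝ) ≤ 2 * (R * T) * (R * Y) :=
        one_le_mul_of_one_le_of_one_le (by linarith) hRY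
      have h2 : ‖(taylor (-(l : ℂ)) (S' l)).eval z‖ ≤ T * (δ * (2 * (R * T) * (R * Y)) ^ T) := by
        rw [taylor_eval, hS', eval_finsetSum]
        calc _ ≤ ∑ m ∈ range T, δ * (2 * (R * T) * (R * Y)) ^ T := by
              refine (norm_sum_le _ _).trans (Finset.sum_le_sum fun m hm => ?_)
              have hm := mem_range.1 hm
              rw [eval_mul, eval_pow, eval_C, eval_X, norm_mul, norm_pow]
              have h3 : ‖z + -(l : ℂ)‖ ≤ R * Y := by
                refine (norm_add_le _ _).trans ?_
                have : (l : ℝ) ≤ R := by exact_mod_cast hl.le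
                rw [norm_neg, Complex.norm_natCast]
                linarith
              calc _ ≤ δ * (2 * (R * T)) ^ m * (R * Y) ^ m := by
                    gcongr
                    exact (hS l hl).2.2 m hm
                _ = δ * (2 * (R * T) * (R * Y)) ^ m := by rw [mul_pow]; ring
                _ ≤ _ := by gcongr
          _ = _ := by simp
      gcongr
      exact norm_lagrangeBasis_le hl hY hz
    rw [hQ, eval_finsetSum]
    calc _ ≤ ∑ l ∈ range R, _ := (norm_sum_le _ _).trans (Finset.sum_le_sum h1)
      _ = _ := by rw [sum_const, card_range, nsmul_eq_mul]; ring

/-- A Schwarz lemma for entire functions whose jets of order `T` at `0, …, R - 1` are small. -/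
theorem norm_le_of_small_jets {f : ℂ → ℂ} (hf : Differentiable ℂ f) {R T K : ℕ}
    (hR : 1 ≤ R) (hT : 1 ≤ T) (hK : 1 ≤ K) {δ G : ℝ}
    (hδ : ∀ l < R, ∀ m < T, ‖iteratedDeriv m f l‖ ≤ δ)
    (hG : ∀ z : ℂ, ‖z‖ ≤ R * (K ^ 2 + 1) → ‖f z‖ ≤ G) {x : ℕ} (hx : x < R * K) :
    ‖f x‖ ≤ 2 * (δ * (R * T * (2 * Real.exp 1 * (K ^ 2 + 2)) ^ (R * T) *
      (2 * (R * T) * (R * (K ^ 2 + 2))) ^ T)) + G / K ^ (R * T) := by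
  obtain ⟨Q, hQ, hQb⟩ := exists_hermite_interpolation hf hR hT hδ (Y := K ^ 2 + 2)
    (by nlinarith [sq_nonneg (K : ℝ)])
  set M := δ * (R * T * (2 * Real.exp 1 * (K ^ 2 + 2)) ^ (R * T) *
      (2 * (R * T) * (R * (K ^ 2 + 2))) ^ T) with hM
  have hQb' : ∀ z : ℂ, ‖z‖ ≤ R * (K ^ 2 + 1) → ‖Q.eval z‖ ≤ M := by
    intro z hz
    exact hQb z (by linarith)
  have hK' : (1 : ℝ) ≤ K := by exact_mod_cast hK
  have hR' : (1 : ℝ) ≤ R := by exact_mod_cast hR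
  obtain ⟨g, hg, hfg⟩ := exists_entire_factor_prod (f := fun z => f z - Q.eval z)
    (hf.sub Q.differentiable) T ((range R).image (fun l : ℕ => (l : ℂ))) (by
      intro y hy
      obtain ⟨l, hl, rfl⟩ := mem_image.1 hy
      exact hQ l (mem_range.1 hl))
  simp only [prod_image (Nat.cast_injective.injOn)] at hfg
  have hρ : (0 : ℝ) < R * (K ^ 2 + 1) := by positivity
  have hxρ : ‖(x : ℂ)‖ ≤ R * (K ^ 2 + 1) := by
    rw [Complex.norm_natCast]
    have : (x : ℝ) ≤ R * K := by exact_mod_cast hx.le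
    nlinarith
  have hGM : ∀ z : ℂ, ‖z‖ ≤ R * (K ^ 2 + 1) → ‖f z - Q.eval z‖ ≤ G + M := fun z hz =>
    (norm_sub_le _ _).trans (add_le_add (hG z hz) (hQb' z hz))
  have hGM0 : 0 ≤ G + M := (norm_nonneg _).trans (hGM 0 (by simpa using hρ.le))
  have hM0 : 0 ≤ M := (norm_nonneg _).trans (hQb' 0 (by simpa using hρ.le))
  have hgb : ‖g x‖ ≤ (G + M) / ((R * K ^ 2) ^ R) ^ T := by
    refine Complex.norm_le_of_forall_mem_frontier_norm_le (U := Metric.ball 0 (R * (K ^ 2 + 1)))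
      Metric.isBounded_ball hg.diffContOnCl ?_ ?_
    · intro z hz
      rw [frontier_ball _ hρ.ne', mem_sphere_zero_iff_norm] at hz
      rw [le_div_iff₀ (by positivity)]
      have h1 : ((R * K ^ 2 : ℝ) ^ R) ^ T ≤ ‖(∏ l ∈ range R, (z - (l : ℂ))) ^ T‖ := by
        rw [norm_pow, norm_prod]
        gcongr
        calc (R * K ^ 2 : ℝ) ^ R = ∏ l ∈ range R, (R * K ^ 2 : ℝ) := by simp
          _ ≤ _ := by
            refine Finset.prod_le_prod (fun _ _ => by positivity) fun l hl => ?_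
            have h2 : (l : ℝ) ≤ R := by exact_mod_cast (mem_range.1 hl).le
            have h3 := norm_sub_norm_le z (l : ℂ)
            rw [hz, Complex.norm_natCast] at h3
            linarith
      calc _ ≤ ‖g z‖ * ‖(∏ l ∈ range R, (z - (l : ℂ))) ^ T‖ := by gcongr
        _ = ‖f z - Q.eval z‖ := by rw [hfg, norm_mul, mul_comm]
        _ ≤ _ := hGM z hz.le
    · rw [closure_ball _ hρ.ne', mem_closedBall_zero_iff]
      exact hxρ
  have hprod : ‖(∏ l ∈ range R, ((x : ℂ) - (l : ℂ))) ^ T‖ ≤ ((R * K : ℝ) ^ R) ^ T := by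
    rw [norm_pow, norm_prod]
    gcongr
    calc _ ≤ ∏ l ∈ range R, (R * K : ℝ) := by
          refine Finset.prod_le_prod (fun _ _ => norm_nonneg _) fun l hl => ?_
          have h1 : ‖(x : ℂ) - (l : ℂ)‖ = |(x : ℝ) - l| := by
            have := Complex.norm_real ((x : ℝ) - l)
            rw [Real.norm_eq_abs] at this
            rw [← this]; push_cast; rfl
          rw [h1, abs_le]
          have h2 : (l : ℝ) ≤ R := by exact_mod_cast (mem_range.1 hl).le
          have h3 : (x : ℝ) ≤ R * K := by exact_mod_cast hx.le
          have h4 : (0 : ℝ) ≤ l := Nat.cast_nonneg l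
          have h5 : (0 : ℝ) ≤ x := Nat.cast_nonneg x
          constructor <;> nlinarith
      _ = _ := by simp
  have hKp : (1 : ℝ) ≤ K ^ (R * T) := one_le_pow₀ hK'
  have hfin : ‖f x - Q.eval (x : ℂ)‖ ≤ (G + M) / K ^ (R * T) := by
    rw [hfg, norm_mul]
    calc _ ≤ ((R * K : ℝ) ^ R) ^ T * ((G + M) / ((R * K ^ 2) ^ R) ^ T) := by gcongr
      _ = _ := by
        have : ((R * K ^ 2 : ℝ) ^ R) ^ T = ((R * K : ℝ) ^ R) ^ T * K ^ (R * T) := by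
          rw [pow_mul, ← mul_pow, ← mul_pow]; ring
        rw [this]
        field_simp
  calc ‖f x‖ = ‖(f x - Q.eval (x : ℂ)) + Q.eval (x : ℂ)‖ := by simp
    _ ≤ (G + M) / K ^ (R * T) + M := (norm_add_le _ _).trans (add_le_add hfin (hQb' _ hxρ))
    _ = M / K ^ (R * T) + M + G / K ^ (R * T) := by ring
    _ ≤ M + M + G / K ^ (R * T) := by gcongr; exact div_le_self hM0 hKp
    _ = _ := by ring

end

section

attribute [local instance] Matrix.seminormedAddCommGroup

/-- Siegel's lemma with twice as many unknowns as equations. -/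
theorem exists_small_int_solution {α β : Type*} [Fintype α] [Fintype β] (A : α → β → ℤ)
    (hα : 0 < Fintype.card α) (hcard : 2 * Fintype.card α ≤ Fintype.card β) {X : ℝ} (hX : 1 ≤ X)
    (hA : ∀ i j, |(A i j : ℝ)| ≤ X) :
    ∃ c : β → ℤ, c ≠ 0 ∧ (∀ i, ∑ j, A i j * c j = 0) ∧
      ∀ j, |(c j : ℝ)| ≤ Fintype.card β * X := by
  obtain ⟨c, hc0, hc, hcn⟩ := Int.Matrix.exists_ne_zero_int_vec_norm_le (Matrix.of A)
    (by omega) hα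
  refine ⟨c, hc0, fun i => ?_, fun j => ?_⟩
  · simpa [Matrix.mulVec, dotProduct] using congrFun hc i
  · have h1 : max 1 ‖Matrix.of A‖ ≤ X := by
      refine max_le hX ((Matrix.norm_le_iff (by linarith)).2 fun i j => ?_)
      rw [Int.norm_eq_abs]
      exact hA i j
    have h2 : (1 : ℝ) ≤ Fintype.card β * max 1 ‖Matrix.of A‖ :=
      one_le_mul_of_one_le_of_one_le (by exact_mod_cast (by omega : 1 ≤ Fintype.card β))
        (le_max_left _ _)
    have h3 : (2 * Fintype.card α : ℝ) ≤ Fintype.card β := by exact_mod_cast hcard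
    have h4 : (0 : ℝ) < Fintype.card α := by exact_mod_cast hα
    have h5 : (Fintype.card α : ℝ) / (Fintype.card β - Fintype.card α) ≤ 1 := by
      rw [div_le_one (by linarith)]; linarith
    calc |(c j : ℝ)| = ‖c j‖ := (Int.norm_eq_abs _).symm
      _ ≤ ‖c‖ := norm_le_pi_norm c j
      _ ≤ _ := hcn
      _ ≤ (Fintype.card β * max 1 ‖Matrix.of A‖) ^ (1 : ℝ) := Real.rpow_le_rpow_of_exponent_le h2 h5
      _ ≤ _ := by rw [Real.rpow_one]; gcongr

end

theorem norm_exp_sub_exp_le {a b : ℂ} {ε M : ℝ} (hab : ‖a - b‖ ≤ ε) (hε : ε ≤ 1) (hb : ‖b‖ ≤ M) :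
    ‖Complex.exp a - Complex.exp b‖ ≤ 2 * ε * Real.exp M := by
  have h1 : Complex.exp a - Complex.exp b = (Complex.exp (a - b) - 1) * Complex.exp b := by
    rw [sub_mul, ← Complex.exp_add]; simp
  rw [h1, norm_mul]
  have h2 : ‖Complex.exp (a - b) - 1‖ ≤ 2 * ‖a - b‖ :=
    Complex.norm_exp_sub_one_le (hab.trans hε)
  have h3 : ‖Complex.exp b‖ ≤ Real.exp M :=
    (Complex.norm_exp_le_exp_norm b).trans (Real.exp_le_exp.2 hb)
  have : 0 ≤ ε := (norm_nonneg _).trans hab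
  gcongr
  linarith

section

open Polynomial

/-- The data entering the auxiliary functions: twisting integers, polynomials, exponents and
coefficients. -/
structure AuxData (ι S : Type*) where
  /-- a common multiple clearing denominators -/
  ν : ℤ
  /-- the distinguished coefficient of the linear form -/
  B : ℤ
  /-- the polynomial parts -/
  P : S → ℂ[X]
  /-- the bases of the powers produced by differentiation -/
  γ : S → ι → ℤ
  /-- the integers defining the twisted derivations -/
  e : S → ℤ
  /-- the coefficients -/
  c : S → ℤ

namespace AuxData

variable {ι S : Type*} [Fintype ι] (D : AuxData ι S)

/-- The coefficient of `exp (ω s z)` in the auxiliary function of order `(τ, σ)`. -/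
noncomputable def term (τ : ι → ℕ) (σ : ℕ) (s : S) (z : ℂ) : ℂ :=
  ((twist D.ν D.B (D.e s))^[σ] (D.P s)).eval z * ∏ i, (D.γ s i : ℂ) ^ τ i

/-- The auxiliary function of order `(τ, σ)` with frequencies `ω`. -/
noncomputable def aux [Fintype S] (ω : S → ℂ) (τ : ι → ℕ) (σ : ℕ) (z : ℂ) : ℂ :=
  ∑ s, (D.c s : ℂ) * (D.term τ σ s z * Complex.exp (ω s * z))

theorem differentiable_aux [Fintype S] (ω : S → ℂ) (τ : ι → ℕ) (σ : ℕ) :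
    Differentiable ℂ (D.aux ω τ σ) := by
  unfold aux term
  fun_prop

theorem deriv_aux [Fintype S] [DecidableEq ι] {ω : S → ℂ} {l : ι → ℂ} (hν : D.ν ≠ 0) (hB : D.B ≠ 0)
    (hω : ∀ s, D.B * ω s = ∑ i, D.γ s i * l i - D.e s) (τ : ι → ℕ) (σ : ℕ) :
    deriv (D.aux ω τ σ) = fun z => ((D.ν : ℂ) * D.B)⁻¹ * D.aux ω τ (σ + 1) z +
      ∑ i, (l i / D.B) * D.aux ω (τ + Pi.single i 1) σ z := by
  funext z
  have hν' : (D.ν : ℂ) ≠ 0 := by exact_mod_cast hν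
  have hB' : (D.B : ℂ) ≠ 0 := by exact_mod_cast hB
  set q : S → ℂ[X] := fun s => (twist D.ν D.B (D.e s))^[σ] (D.P s) with hq
  set g : S → ℂ := fun s => ∏ i, (D.γ s i : ℂ) ^ τ i with hg
  have h1 : HasDerivAt (D.aux ω τ σ) (∑ s, (D.c s : ℂ) *
      (((derivative (q s)).eval z * g s) * Complex.exp (ω s * z) +
        (q s).eval z * g s * (Complex.exp (ω s * z) * (ω s * 1)))) z := by
    unfold aux term
    refine HasDerivAt.fun_sum fun s _ => HasDerivAt.const_mul _ (HasDerivAt.mul ?_ ?_)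
    · exact ((q s).hasDerivAt z).mul_const _
    · exact ((hasDerivAt_id z).const_mul (ω s)).cexp
  rw [h1.deriv]
  have h2 : ∀ i, D.aux ω (τ + Pi.single i 1) σ z =
      ∑ s, (D.c s : ℂ) * ((q s).eval z * g s * D.γ s i * Complex.exp (ω s * z)) := by
    intro i
    refine Finset.sum_congr rfl fun s _ => ?_
    have : ∏ j, (D.γ s j : ℂ) ^ ((τ + Pi.single i 1 : ι → ℕ) j) = g s * D.γ s i := by
      simp only [Pi.add_apply, pow_add, Finset.prod_mul_distrib, hg]
      congr 1
      rw [Finset.prod_eq_single i]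
      · simp
      · intro j _ hj; simp [hj]
      · simp
    simp only [term]
    rw [this]
    ring
  have h3 : D.aux ω τ (σ + 1) z = ∑ s, (D.c s : ℂ) *
      ((D.ν * D.B * (derivative (q s)).eval z - D.ν * D.e s * (q s).eval z) * g s *
        Complex.exp (ω s * z)) := by
    refine Finset.sum_congr rfl fun s _ => ?_
    simp only [term, Function.iterate_succ_apply']
    simp [twist, hq, hg]
  simp only [h2, h3, Finset.mul_sum]
  rw [Finset.sum_comm, ← Finset.sum_add_distrib]
  refine Finset.sum_congr rfl fun s _ => ?_
  have h4 : ω s = (∑ i, D.γ s i * l i - D.e s) / D.B := by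
    rw [← hω s]; field_simp
  have h5 : ∑ i, l i / D.B * (D.c s * ((q s).eval z * g s * D.γ s i * Complex.exp (ω s * z))) =
      (∑ i, D.γ s i * l i) / D.B * (D.c s * ((q s).eval z * g s * Complex.exp (ω s * z))) := by
    rw [Finset.sum_div, Finset.sum_mul]
    exact Finset.sum_congr rfl fun i _ => by ring
  rw [h5]
  have h6 : (∑ i, D.γ s i * l i) / (D.B : ℂ) = ω s + D.e s / D.B := by
    rw [h4]; ring
  rw [h6]
  field_simp
  ring

theorem norm_iteratedDeriv_aux_le [Fintype S] [DecidableEq ι] {ω : S → ℂ} {l : ι → ℂ} (hν : D.ν ≠ 0)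
    (hB : D.B ≠ 0) (hω : ∀ s, D.B * ω s = ∑ i, D.γ s i * l i - D.e s) {T : ℕ} {δ : ℝ} {x : ℂ}
    (hδ : ∀ τ : ι → ℕ, ∀ σ : ℕ, (∀ i, τ i < T) → σ < T → ‖D.aux ω τ σ x‖ ≤ δ)
    (m : ℕ) (τ : ι → ℕ) (σ : ℕ) (hτ : ∀ i, τ i + m < T) (hσ : σ + m < T) :
    ‖iteratedDeriv m (D.aux ω τ σ) x‖ ≤ (1 + ∑ i, ‖l i‖) ^ m * δ := by
  induction m generalizing τ σ with
  | zero => simpa using hδ τ σ (by simpa using hτ) (by simpa using hσ)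
  | succ m ih =>
    have hcd : ∀ τ σ, ContDiffAt ℂ m (D.aux ω τ σ) x := fun τ σ =>
      (D.differentiable_aux ω τ σ).contDiff.contDiffAt
    rw [iteratedDeriv_succ', D.deriv_aux hν hB hω, iteratedDeriv_fun_add
      (contDiffAt_const.mul (hcd _ _))
      (ContDiffAt.sum fun i _ => contDiffAt_const.mul (hcd _ _)),
      iteratedDeriv_fun_sum (fun i _ => contDiffAt_const.mul (hcd _ _))]
    simp only [iteratedDeriv_const_mul_field]
    have hB1 : (1 : ℝ) ≤ ‖(D.B : ℂ)‖ := by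
      rw [Complex.norm_intCast]; exact_mod_cast Int.one_le_abs hB
    have hν1 : (1 : ℝ) ≤ ‖(D.ν : ℂ)‖ := by
      rw [Complex.norm_intCast]; exact_mod_cast Int.one_le_abs hν
    have h1 := ih τ (σ + 1) (fun i => by have := hτ i; omega) (by omega)
    have h2 : ∀ i, ‖iteratedDeriv m (D.aux ω (τ + Pi.single i 1) σ) x‖ ≤
        (1 + ∑ i, ‖l i‖) ^ m * δ := fun i => ih _ σ (fun j => by
      have h3 := hτ j
      have h4 : (Pi.single i 1 : ι → ℕ) j ≤ 1 := by
        by_cases h : j = i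
        · subst h; simp
        · simp [h]
      simp only [Pi.add_apply]
      omega) (by omega)
    have h0 : 0 ≤ (1 + ∑ i, ‖l i‖) ^ m * δ := (norm_nonneg _).trans h1
    calc _ ≤ ‖((D.ν : ℂ) * D.B)⁻¹‖ * ((1 + ∑ i, ‖l i‖) ^ m * δ) +
          ∑ i, ‖l i / D.B‖ * ((1 + ∑ i, ‖l i‖) ^ m * δ) := by
          refine (norm_add_le _ _).trans (add_le_add ?_ ((norm_sum_le _ _).trans
            (Finset.sum_le_sum fun i _ => ?_)))
          · rw [norm_mul]; gcongr
          · rw [norm_mul]; gcongr; exact h2 i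
      _ ≤ 1 * ((1 + ∑ i, ‖l i‖) ^ m * δ) + ∑ i, ‖l i‖ * ((1 + ∑ i, ‖l i‖) ^ m * δ) := by
          gcongr
          · rw [norm_inv, norm_mul]
            exact inv_le_one_of_one_le₀ (one_le_mul_of_one_le_of_one_le hν1 hB1)
          · rw [norm_div]
            exact div_le_self (norm_nonneg _) hB1
      _ = _ := by rw [← Finset.sum_mul]; ring

theorem norm_term_le {τ : ι → ℕ} {σ T : ℕ} {s : S} {z : ℂ} {ρ W G Γ : ℝ} (hT : ∀ i, τ i ≤ T)
    (hσ : σ ≤ T) (hW1 : 1 ≤ W) (hΓ1 : 1 ≤ Γ)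
    (hW : |(D.ν * D.B : ℝ)| + |(D.ν * D.e s : ℝ)| ≤ W) (hΓ : ∀ i, |(D.γ s i : ℝ)| ≤ Γ)
    (hG : ∀ z : ℂ, ‖z‖ ≤ ρ + T → ‖(D.P s).eval z‖ ≤ G) (hz : ‖z‖ ≤ ρ) :
    ‖D.term τ σ s z‖ ≤ W ^ T * G * Γ ^ (Fintype.card ι * T) := by
  have hG0 : 0 ≤ G := (norm_nonneg _).trans (hG z (hz.trans (by simp)))
  have h1 : ‖((twist D.ν D.B (D.e s))^[σ] (D.P s)).eval z‖ ≤ W ^ σ * G :=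
    norm_twist_iterate_eval_le σ hW (ρ := ρ) (fun w hw => hG w (hw.trans (by gcongr))) hz
  have h2 : ‖∏ i, (D.γ s i : ℂ) ^ τ i‖ ≤ Γ ^ (Fintype.card ι * T) := by
    rw [norm_prod]
    calc _ ≤ ∏ _i : ι, Γ ^ T := by
          refine Finset.prod_le_prod (fun _ _ => norm_nonneg _) fun i _ => ?_
          rw [norm_pow, Complex.norm_intCast]
          exact (pow_le_pow_left₀ (abs_nonneg _) (hΓ i) _).trans (pow_le_pow_right₀ hΓ1 (hT i))
      _ = _ := by rw [Finset.prod_const, ← pow_mul, Finset.card_univ, mul_comm]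
  rw [term, norm_mul]
  gcongr
  refine h1.trans ?_
  gcongr

theorem exists_int_term {τ : ι → ℕ} {σ : ℕ} {s : S} (hP : D.P s ∈ integralSubring D.ν) (x : ℕ) :
    ∃ a : ℤ, D.term τ σ s x = a := by
  obtain ⟨a, ha⟩ := exists_int_eval_of_mem (twist_iterate_mem (B := D.B) (m := D.e s) hP σ) x
  exact ⟨a * ∏ i, D.γ s i ^ τ i, by rw [term, ha]; push_cast; rfl⟩

end AuxData

end

section

open Polynomial

namespace AuxData

variable {ι S : Type*} [Fintype ι] [Fintype S] (D : AuxData ι S)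

theorem exists_int_aux {ω : S → ℂ} {A : S → ℕ} (hA : ∀ s, Complex.exp (ω s) = A s)
    (hP : ∀ s, D.P s ∈ integralSubring D.ν) (τ : ι → ℕ) (σ : ℕ) (x : ℕ) :
    ∃ a : ℤ, D.aux ω τ σ x = a := by
  choose a ha using fun s => D.exists_int_term (τ := τ) (σ := σ) (hP s) x
  refine ⟨∑ s, D.c s * (a s * A s ^ x), ?_⟩
  push_cast
  refine Finset.sum_congr rfl fun s _ => ?_
  rw [ha, ← hA, ← Complex.exp_nat_mul, mul_comm (ω s)]

theorem norm_aux_le {ω : S → ℂ} {τ : ι → ℕ} {σ : ℕ} {z : ℂ} {ρ X Ω Cc : ℝ}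
    (hc : ∀ s, |(D.c s : ℝ)| ≤ Cc) (hX : ∀ s, ‖D.term τ σ s z‖ ≤ X) (hω : ∀ s, ‖ω s‖ ≤ Ω)
    (hz : ‖z‖ ≤ ρ) :
    ‖D.aux ω τ σ z‖ ≤ Fintype.card S * (Cc * (X * Real.exp (Ω * ρ))) := by
  calc _ ≤ ∑ _s : S, Cc * (X * Real.exp (Ω * ρ)) := by
        refine (norm_sum_le _ _).trans (Finset.sum_le_sum fun s _ => ?_)
        have h0 : 0 ≤ X := (norm_nonneg _).trans (hX s)
        have h1 : 0 ≤ Cc := (abs_nonneg _).trans (hc s)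
        have h2 : ‖Complex.exp (ω s * z)‖ ≤ Real.exp (Ω * ρ) := by
          refine (Complex.norm_exp_le_exp_norm _).trans (Real.exp_le_exp.2 ?_)
          have := (norm_nonneg _).trans (hω s)
          rw [norm_mul]
          gcongr
          exact hω s
        rw [norm_mul, norm_mul, Complex.norm_intCast]
        gcongr
        exacts [hc s, hX s]
    _ = _ := by simp

theorem norm_aux_sub_aux_le {ω ω' : S → ℂ} {τ : ι → ℕ} {σ : ℕ} {z : ℂ} {ρ X Ω Cc ε : ℝ}
    (hc : ∀ s, |(D.c s : ℝ)| ≤ Cc) (hX : ∀ s, ‖D.term τ σ s z‖ ≤ X)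
    (hω : ∀ s, ‖ω s‖ ≤ Ω) (hωω' : ∀ s, ‖ω' s - ω s‖ ≤ ε) (hε : ε * ρ ≤ 1) (hz : ‖z‖ ≤ ρ) :
    ‖D.aux ω' τ σ z - D.aux ω τ σ z‖ ≤
      2 * (ε * ρ) * (Fintype.card S * (Cc * (X * Real.exp (Ω * ρ)))) := by
  have hρ : 0 ≤ ρ := (norm_nonneg _).trans hz
  calc _ ≤ ∑ _s : S, Cc * (X * (2 * (ε * ρ) * Real.exp (Ω * ρ))) := by
        rw [aux, aux, ← Finset.sum_sub_distrib]
        refine (norm_sum_le _ _).trans (Finset.sum_le_sum fun s _ => ?_)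
        have h0 : 0 ≤ X := (norm_nonneg _).trans (hX s)
        have h1 : 0 ≤ Cc := (abs_nonneg _).trans (hc s)
        have hΩ := (norm_nonneg _).trans (hω s)
        have hε0 := (norm_nonneg _).trans (hωω' s)
        have h2 : ‖Complex.exp (ω' s * z) - Complex.exp (ω s * z)‖ ≤
            2 * (ε * ρ) * Real.exp (Ω * ρ) := by
          refine norm_exp_sub_exp_le ?_ hε ?_
          · rw [← sub_mul, norm_mul]
            gcongr
            exact hωω' s
          · rw [norm_mul]
            gcongr
            exact hω s
        rw [← mul_sub, ← mul_sub, norm_mul, norm_mul, Complex.norm_intCast]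
        gcongr
        exacts [hc s, hX s]
    _ = _ := by simp; ring

theorem vanishing_step [DecidableEq ι] {ω ω' : S → ℂ} {l : ι → ℂ} {A : S → ℕ} (hν : D.ν ≠ 0)
    (hB : D.B ≠ 0) (hω' : ∀ s, D.B * ω' s = ∑ i, D.γ s i * l i - D.e s)
    (hA : ∀ s, Complex.exp (ω s) = A s) (hP : ∀ s, D.P s ∈ integralSubring D.ν)
    {T T₁ T' R K : ℕ} (hTT : T₁ + T' ≤ T) (hR : 1 ≤ R) (hT' : 1 ≤ T') (hK : 1 ≤ K)
    {X Ω Cc ε H η : ℝ} (hc : ∀ s, |(D.c s : ℝ)| ≤ Cc)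
    (hX : ∀ τ : ι → ℕ, ∀ σ s, ∀ z : ℂ, (∀ i, τ i < T) → σ < T → ‖z‖ ≤ R * (K ^ 2 + 1) →
      ‖D.term τ σ s z‖ ≤ X)
    (hΩ : ∀ s, ‖ω s‖ ≤ Ω) (hΩ' : ∀ s, ‖ω' s‖ ≤ Ω) (hωω' : ∀ s, ‖ω' s - ω s‖ ≤ ε)
    (hε : ε * (R * (K ^ 2 + 1)) ≤ 1)
    (hH : Fintype.card S * (Cc * (X * Real.exp (Ω * (R * (K ^ 2 + 1))))) ≤ H)
    (hη : 2 * (ε * (R * (K ^ 2 + 1))) * H ≤ η)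
    (hsmall : 2 * ((1 + ∑ i, ‖l i‖) ^ T' * η * (R * T' * (2 * Real.exp 1 * (K ^ 2 + 2)) ^ (R * T') *
      (2 * (R * T') * (R * (K ^ 2 + 2))) ^ T')) + H / K ^ (R * T') + η < 1)
    (hvan : ∀ τ : ι → ℕ, ∀ σ, (∀ i, τ i < T) → σ < T → ∀ x < R, D.aux ω τ σ (x : ℕ) = 0)
    (τ : ι → ℕ) (σ : ℕ) (hτ : ∀ i, τ i < T₁) (hσ : σ < T₁) (x : ℕ) (hx : x < R * K) :
    D.aux ω τ σ x = 0 := by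
  rcases isEmpty_or_nonempty S with hS | ⟨⟨s₀⟩⟩
  · simp [aux]
  have hε0 : 0 ≤ ε := (norm_nonneg _).trans (hωω' s₀)
  have hR1 : (1 : ℝ) ≤ R := by exact_mod_cast hR
  have hK1 : (1 : ℝ) ≤ K := by exact_mod_cast hK
  have hdiff : ∀ τ : ι → ℕ, ∀ σ, (∀ i, τ i < T) → σ < T → ∀ x : ℕ, x < R * K →
      ‖D.aux ω' τ σ x - D.aux ω τ σ x‖ ≤ η := by
    intro τ σ hτ hσ x hx
    have hxρ : ‖(x : ℂ)‖ ≤ R * (K ^ 2 + 1) := by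
      rw [Complex.norm_natCast]
      have : (x : ℝ) ≤ R * K := by exact_mod_cast hx.le
      nlinarith
    refine (D.norm_aux_sub_aux_le hc (fun s => hX τ σ s x hτ hσ hxρ) hΩ hωω' hε hxρ).trans ?_
    refine le_trans ?_ hη
    gcongr
  have hjets : ∀ l' < R, ∀ m < T', ‖iteratedDeriv m (D.aux ω' τ σ) (l' : ℕ)‖ ≤
      (1 + ∑ i, ‖l i‖) ^ T' * η := by
    intro x hx m hm
    have hη' : ∀ τ : ι → ℕ, ∀ σ : ℕ, (∀ i, τ i < T) → σ < T → ‖D.aux ω' τ σ (x : ℕ)‖ ≤ η := by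
      intro τ σ hτ hσ
      have := hdiff τ σ hτ hσ x (by nlinarith)
      rwa [hvan τ σ hτ hσ x hx, sub_zero] at this
    refine (D.norm_iteratedDeriv_aux_le hν hB hω' hη' m τ σ (fun i => by have := hτ i; omega)
      (by omega)).trans ?_
    have hη0 : 0 ≤ η := (norm_nonneg _).trans (hη' τ σ (fun i => by have := hτ i; omega) (by omega))
    have h1 : (1 : ℝ) ≤ 1 + ∑ i, ‖l i‖ := by
      have : 0 ≤ ∑ i, ‖l i‖ := Finset.sum_nonneg fun i _ => norm_nonneg _
      linarith
    gcongr
  have hbig := norm_le_of_small_jets (D.differentiable_aux ω' τ σ) hR hT' hK hjets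
    (G := H) (fun z hz => (D.norm_aux_le hc
      (fun s => hX τ σ s z (fun i => by have := hτ i; omega) (by omega) hz) hΩ' hz).trans hH) hx
  have hd := hdiff τ σ (fun i => by have := hτ i; omega) (by omega) x hx
  obtain ⟨a, ha⟩ := D.exists_int_aux hA hP τ σ x
  have hlt : ‖D.aux ω τ σ x‖ < 1 := by
    calc ‖D.aux ω τ σ x‖ = ‖D.aux ω' τ σ x - (D.aux ω' τ σ x - D.aux ω τ σ x)‖ := by simp
      _ ≤ ‖D.aux ω' τ σ x‖ + ‖D.aux ω' τ σ x - D.aux ω τ σ x‖ := norm_sub_le _ _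
      _ ≤ _ := add_le_add hbig hd
      _ < 1 := hsmall
  rw [ha, Complex.norm_intCast] at hlt
  have : |a| < 1 := by exact_mod_cast hlt
  rw [ha, Int.abs_lt_one_iff.1 this]
  simp

end AuxData

end

theorem pow_le_exp_mul (x : ℝ) (hx : 0 ≤ x) (n : ℕ) : x ^ n ≤ Real.exp (n * x) := by
  rw [Real.exp_nat_mul]
  exact pow_le_pow_left₀ hx (by linarith [Real.add_one_le_exp x]) n

theorem self_le_exp (x : ℝ) : x ≤ Real.exp x := by linarith [Real.add_one_le_exp x]

theorem total_bound_le {a J₀ J h K : ℕ} (hh : 1 ≤ h) (hK : 1 ≤ K) (hKh : K ≤ h) {x₁ Λ₁ X : ℝ}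
    (hx₁ : 0 ≤ x₁) (hΛ₁ : 0 ≤ Λ₁) (hX : X ≤ Real.exp (x₁ * (h * K ^ (a + 2)))) (hX0 : 0 ≤ X) :
    ((h * K ^ J₀ : ℕ) : ℝ) * (((h * K ^ J₀ : ℕ) : ℝ) * (X * Real.exp (K ^ a * Λ₁ * h)) *
      (X * Real.exp (K ^ a * Λ₁ * ((h * K ^ J : ℕ) * (K ^ 2 + 1))))) ≤
      Real.exp ((2 * (1 + J₀) + 2 * x₁ + 3 * Λ₁) * ((h * K ^ J : ℕ) * K ^ (a + 2))) := by
  have hK1 : (1 : ℝ) ≤ K := by exact_mod_cast hK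
  have hh1 : (1 : ℝ) ≤ h := by exact_mod_cast hh
  have hN : ((h * K ^ J₀ : ℕ) : ℝ) ≤ Real.exp ((1 + J₀) * h) := by
    push_cast
    rw [add_mul, one_mul, Real.exp_add]
    have : (K : ℝ) ≤ h := by exact_mod_cast hKh
    gcongr
    · exact self_le_exp _
    · exact (pow_le_exp_mul _ (by linarith) _).trans (Real.exp_le_exp.2 (by gcongr))
  set R : ℝ := ((h * K ^ J : ℕ) : ℝ) with hR
  have hRh : (h : ℝ) ≤ R := by
    rw [hR]; push_cast
    exact le_mul_of_one_le_right (by linarith) (one_le_pow₀ hK1)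
  calc _ ≤ Real.exp ((1 + J₀) * h) * (Real.exp ((1 + J₀) * h) *
        (Real.exp (x₁ * (h * K ^ (a + 2))) * Real.exp (K ^ a * Λ₁ * h)) *
        (Real.exp (x₁ * (h * K ^ (a + 2))) * Real.exp (K ^ a * Λ₁ * (R * (K ^ 2 + 1))))) := by
        gcongr
    _ = Real.exp (2 * (1 + J₀) * h + 2 * (x₁ * (h * K ^ (a + 2))) + K ^ a * Λ₁ * h +
        K ^ a * Λ₁ * (R * (K ^ 2 + 1))) := by
        simp only [← Real.exp_add]
        congr 1; ring
    _ ≤ _ := by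
        rw [Real.exp_le_exp]
        have e0 : (1 : ℝ) ≤ K ^ 2 := one_le_pow₀ hK1
        have e1 : (h : ℝ) ≤ R * K ^ (a + 2) :=
          hRh.trans (le_mul_of_one_le_right (by linarith) (one_le_pow₀ hK1))
        have e2 : (h : ℝ) * K ^ (a + 2) ≤ R * K ^ (a + 2) := by gcongr
        have e3 : (K : ℝ) ^ a * Λ₁ * h ≤ Λ₁ * (R * K ^ (a + 2)) := by
          have : (K : ℝ) ^ a ≤ K ^ (a + 2) := pow_le_pow_right₀ hK1 (by omega)
          calc (K : ℝ) ^ a * Λ₁ * h ≤ K ^ (a + 2) * Λ₁ * R := by gcongr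
            _ = _ := by ring
        have e4 : (K : ℝ) ^ a * Λ₁ * (R * (K ^ 2 + 1)) ≤ 2 * Λ₁ * (R * K ^ (a + 2)) := by
          calc (K : ℝ) ^ a * Λ₁ * (R * (K ^ 2 + 1)) ≤ K ^ a * Λ₁ * (R * (K ^ 2 + K ^ 2)) := by
                gcongr
            _ = _ := by ring
        calc _ ≤ 2 * (1 + J₀) * (R * K ^ (a + 2)) + 2 * (x₁ * (R * K ^ (a + 2))) +
              Λ₁ * (R * K ^ (a + 2)) + 2 * Λ₁ * (R * K ^ (a + 2)) := by gcongr
          _ = _ := by ring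

theorem exists_smallness_constant (a J₀ : ℕ) {K : ℕ} {c₁ A : ℝ} (hc₁ : 0 ≤ c₁) (hA : 0 ≤ A)
    (hK : Real.exp (c₁ + 2) ≤ K) :
    ∃ C : ℝ, 0 ≤ C ∧ ∀ h J R T : ℕ, 1 ≤ h → J ≤ J₀ → R = h * K ^ J → T = K ^ (a + 2) →
      ∀ ε H η : ℝ, 0 ≤ ε → ε ≤ K ^ a * Real.exp (-C * h) → H = Real.exp (c₁ * (R * T)) →
      η = 2 * (ε * (R * (K ^ 2 + 1))) * H →
      ε * (R * (K ^ 2 + 1)) ≤ 1 ∧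
      2 * (A ^ T * η * (R * T * (2 * Real.exp 1 * (K ^ 2 + 2)) ^ (R * T) *
        (2 * (R * T) * (R * (K ^ 2 + 2))) ^ T)) + H / K ^ (R * T) + η < 1 := by
  set T : ℕ := K ^ (a + 2) with hT
  set U : ℝ := (K : ℝ) ^ J₀ with hU
  set z₁ : ℝ := K ^ a + 2 * (U * (K ^ 2 + 1)) + c₁ * (U * T) with hz₁
  set z₂ : ℝ := 2 + T * A + U * T + U * T * (2 * Real.exp 1 * (K ^ 2 + 2)) +
    T * (2 * (U * T) + U * (K ^ 2 + 2)) with hz₂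
  have hU0 : 0 ≤ U := by positivity
  have hz₁0 : 0 ≤ z₁ := by positivity
  have hz₂0 : 0 ≤ z₂ := by positivity
  have hK1 : (1 : ℝ) ≤ K := le_trans (by simpa using by linarith) hK
  refine ⟨z₁ + z₂ + 2, by positivity, ?_⟩
  rintro h J R _ hh hJ rfl rfl ε H η hε hεC hH hη
  set R : ℕ := h * K ^ J with hR
  have hh1 : (1 : ℝ) ≤ h := by exact_mod_cast hh
  have hRU : (R : ℝ) ≤ h * U := by
    rw [hR, hU]; push_cast
    gcongr
  have hRT : 1 ≤ R * T := by
    have : 0 < K := by exact_mod_cast (by linarith : (0 : ℝ) < K)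
    exact Nat.one_le_iff_ne_zero.2 (by positivity)
  have hRT' : (1 : ℝ) ≤ R * T := by exact_mod_cast hRT
  have hH1 : 1 ≤ H := by
    rw [hH]; exact Real.one_le_exp (by positivity)
  have hη0 : 0 ≤ η := by rw [hη]; positivity
  have hηz : η ≤ Real.exp (-(z₂ + 2) * h) := by
    calc η = ε * (2 * (R * (K ^ 2 + 1))) * H := by rw [hη]; ring
      _ ≤ K ^ a * Real.exp (-(z₁ + z₂ + 2) * h) * Real.exp (2 * (R * (K ^ 2 + 1))) *
          Real.exp (c₁ * (R * T)) := by
          rw [hH]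
          gcongr
          exact self_le_exp _
      _ ≤ Real.exp (K ^ a) * Real.exp (-(z₁ + z₂ + 2) * h) * Real.exp (2 * (R * (K ^ 2 + 1))) *
          Real.exp (c₁ * (R * T)) := by
          gcongr
          exact self_le_exp _
      _ = Real.exp (K ^ a + 2 * (R * (K ^ 2 + 1)) + c₁ * (R * T) - (z₁ + z₂ + 2) * h) := by
          simp only [← Real.exp_add]
          congr 1; ring
      _ ≤ _ := by
          rw [Real.exp_le_exp]
          have : (K : ℝ) ^ a + 2 * (R * (K ^ 2 + 1)) + c₁ * (R * T) ≤ z₁ * h := by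
            calc _ ≤ (K : ℝ) ^ a * h + 2 * (h * U * (K ^ 2 + 1)) + c₁ * (h * U * T) := by
                  gcongr
                  exact le_mul_of_one_le_right (by positivity) hh1
              _ = _ := by rw [hz₁]; ring
          linarith
  have hM : 2 * (A ^ T * (R * T * (2 * Real.exp 1 * (K ^ 2 + 2)) ^ (R * T) *
        (2 * (R * T) * (R * (K ^ 2 + 2))) ^ T)) ≤ Real.exp (z₂ * h) := by
    calc _ ≤ Real.exp 2 * (Real.exp (T * A) * (Real.exp (R * T) *
          Real.exp ((R * T : ℕ) * (2 * Real.exp 1 * (K ^ 2 + 2))) *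
          (Real.exp (2 * (R * T)) * Real.exp (R * (K ^ 2 + 2))) ^ T)) := by
          gcongr
          · exact self_le_exp _
          · exact pow_le_exp_mul _ hA _
          · exact self_le_exp _
          · exact pow_le_exp_mul _ (by positivity) _
          · exact self_le_exp _
          · exact self_le_exp _
      _ = Real.exp (2 + T * A + R * T + R * T * (2 * Real.exp 1 * (K ^ 2 + 2)) +
          T * (2 * (R * T) + R * (K ^ 2 + 2))) := by
          simp only [← Real.exp_add, ← Real.exp_nat_mul]
          congr 1; push_cast; ring
      _ ≤ _ := by
          rw [Real.exp_le_exp]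
          have e1 : (T : ℝ) * A ≤ T * A * h := le_mul_of_one_le_right (by positivity) hh1
          have e2 : (R : ℝ) * T ≤ h * U * T := by gcongr
          have e3 : (R : ℝ) * T * (2 * Real.exp 1 * (K ^ 2 + 2)) ≤
              h * U * T * (2 * Real.exp 1 * (K ^ 2 + 2)) := by gcongr
          have e4 : (T : ℝ) * (2 * (R * T) + R * (K ^ 2 + 2)) ≤
              T * (2 * (h * U * T) + h * U * (K ^ 2 + 2)) := by gcongr
          calc _ ≤ 2 * h + T * A * h + h * U * T + h * U * T * (2 * Real.exp 1 * (K ^ 2 + 2)) +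
                T * (2 * (h * U * T) + h * U * (K ^ 2 + 2)) := by linarith
            _ = _ := by rw [hz₂]; ring
  have he2 : Real.exp (-2) < 1 / 4 := by
    rw [Real.exp_neg, inv_lt_comm₀ (Real.exp_pos _) (by norm_num)]
    have h1 : (2.7182818283 : ℝ) < Real.exp 1 := Real.exp_one_gt_d9
    have h2 : Real.exp 2 = Real.exp 1 * Real.exp 1 := by rw [← Real.exp_add]; norm_num
    rw [h2]; nlinarith
  have hη2 : η ≤ Real.exp (-2) := hηz.trans (Real.exp_le_exp.2 (by nlinarith))
  clear_value R T
  refine ⟨?_, ?_⟩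
  · have : ε * (R * (K ^ 2 + 1)) * 1 ≤ ε * (R * (K ^ 2 + 1)) * (2 * H) := by
      gcongr; linarith
    have h3 : ε * (R * (K ^ 2 + 1)) * (2 * H) = η := by rw [hη]; ring
    linarith
  · have h1 : 2 * (A ^ T * η * (R * T * (2 * Real.exp 1 * (K ^ 2 + 2)) ^ (R * T) *
        (2 * (R * T) * (R * (K ^ 2 + 2))) ^ T)) ≤ Real.exp (-2) := by
      calc _ = 2 * (A ^ T * (R * T * (2 * Real.exp 1 * (K ^ 2 + 2)) ^ (R * T) *
            (2 * (R * T) * (R * (K ^ 2 + 2))) ^ T)) * η := by ring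
        _ ≤ Real.exp (z₂ * h) * Real.exp (-(z₂ + 2) * h) :=
            mul_le_mul hM hηz hη0 (Real.exp_pos _).le
        _ = Real.exp (-2 * h) := by rw [← Real.exp_add]; congr 1; ring
        _ ≤ _ := Real.exp_le_exp.2 (by linarith)
    have h2 : H / K ^ (R * T) ≤ Real.exp (-2) := by
      rw [div_le_iff₀ (by positivity)]
      calc H = Real.exp (c₁ * (R * T)) := hH
        _ ≤ Real.exp (-2 + (R * T : ℕ) * (c₁ + 2)) := by
            rw [Real.exp_le_exp]; push_cast; nlinarith
        _ = Real.exp (-2) * Real.exp (c₁ + 2) ^ (R * T) := by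
            rw [Real.exp_add, Real.exp_nat_mul (c₁ + 2) (R * T)]
        _ ≤ _ := by gcongr
    linarith only [h1, h2, hη2, he2]

section

open Polynomial

theorem lcmUpto_le_exp (h : ℕ) : (Nat.lcmUpto h : ℝ) ≤ Real.exp (6 * h) := by
  have h0 : (0 : ℝ) < Nat.lcmUpto h := by exact_mod_cast Nat.lcmUpto_pos h
  rw [← Real.log_le_iff_le_exp h0, ← Chebyshev.psi_eq_log_lcmUpto]
  refine (Chebyshev.psi_le_const_mul_self (Nat.cast_nonneg h)).trans ?_
  have h4 : Real.log 4 ≤ 2 := by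
    have : (4 : ℝ) = 2 ^ 2 := by norm_num
    rw [this, Real.log_pow]
    have := Real.log_two_lt_d9
    push_cast; linarith
  gcongr
  linarith

theorem dvd_lcmUpto {h j : ℕ} (h1 : 1 ≤ j) (h2 : j ≤ h) :
    (j : ℤ) ∣ (Nat.lcmUpto h : ℤ) := by
  exact_mod_cast Finset.dvd_lcm (f := id) (mem_Icc.2 ⟨h1, h2⟩)

theorem AuxData.exists_vanishing_coeffs {ι S : Type*} [Fintype ι] [Fintype S] (D : AuxData ι S)
    {ω : S → ℂ} {A : S → ℕ} (hA : ∀ s, Complex.exp (ω s) = A s)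
    (hP : ∀ s, D.P s ∈ integralSubring D.ν) {T R : ℕ} (hT : 0 < T) (hR : 0 < R)
    {X Ω : ℝ} (hX1 : 1 ≤ X) (hΩ0 : 0 ≤ Ω)
    (hX : ∀ τ : ι → ℕ, ∀ σ s, ∀ x < R, (∀ i, τ i < T) → σ < T → ‖D.term τ σ s (x : ℕ)‖ ≤ X)
    (hΩ : ∀ s, ‖ω s‖ ≤ Ω) (hcard : 2 * (R * T ^ (Fintype.card ι + 1)) ≤ Fintype.card S) :
    ∃ c : S → ℤ, c ≠ 0 ∧ (∀ s, |(c s : ℝ)| ≤ Fintype.card S * (X * Real.exp (Ω * R))) ∧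
      ∀ τ : ι → ℕ, ∀ σ, (∀ i, τ i < T) → σ < T → ∀ x < R,
        ({D with c := c} : AuxData ι S).aux ω τ σ (x : ℕ) = 0 := by
  classical
  choose a ha using fun (τ : ι → ℕ) σ s x => D.exists_int_term (τ := τ) (σ := σ) (hP s) x
  have hcardα : Fintype.card (Fin R × (ι → Fin T) × Fin T) = R * T ^ (Fintype.card ι + 1) := by
    simp [pow_succ]
  obtain ⟨c, hc0, hc, hcb⟩ := exists_small_int_solution
    (fun (y : Fin R × (ι → Fin T) × Fin T) s =>
      a (fun i => y.2.1 i) y.2.2 s y.1 * (A s : ℤ) ^ (y.1 : ℕ))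
    (by rw [hcardα]; positivity) (by rwa [hcardα]) (X := X * Real.exp (Ω * R))
    (one_le_mul_of_one_le_of_one_le hX1 (Real.one_le_exp (by positivity))) (by
      intro y s
      have h1 : ‖((a (fun i => y.2.1 i) y.2.2 s y.1 : ℤ) : ℂ)‖ ≤ X := by
        rw [← ha]
        exact hX _ _ s _ y.1.2 (fun i => (y.2.1 i).2) y.2.2.2
      have h2 : ‖((A s : ℂ)) ^ (y.1 : ℕ)‖ ≤ Real.exp (Ω * R) := by
        rw [← hA, ← Complex.exp_nat_mul]
        refine (Complex.norm_exp_le_exp_norm _).trans (Real.exp_le_exp.2 ?_)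
        rw [norm_mul, Complex.norm_natCast, mul_comm]
        have : ((y.1 : ℕ) : ℝ) ≤ R := by exact_mod_cast y.1.2.le
        gcongr
        exact hΩ s
      have h3 : ‖((a (fun i => y.2.1 i) y.2.2 s y.1 * (A s : ℤ) ^ (y.1 : ℕ) : ℤ) : ℂ)‖ ≤
          X * Real.exp (Ω * R) := by
        push_cast
        rw [norm_mul]
        gcongr
      rwa [Complex.norm_intCast] at h3)
  refine ⟨c, hc0, hcb, fun τ σ hτ hσ x hx => ?_⟩
  have h1 := hc ⟨⟨x, hx⟩, fun i => ⟨τ i, hτ i⟩, ⟨σ, hσ⟩⟩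
  have h2 := congrArg (Int.cast : ℤ → ℂ) h1
  push_cast at h2
  rw [← h2]
  refine Finset.sum_congr rfl fun s _ => ?_
  have h3 : ({D with c := c} : AuxData ι S).term τ σ s x = D.term τ σ s x := rfl
  rw [h3, ha, ← hA, ← Complex.exp_nat_mul, mul_comm (ω s)]
  ring

section Construction

variable {ι : Type*} [Fintype ι]

/-- The auxiliary data attached to the linear form `b₀ + ∑ bᵢ log pᵢ + B log q`. -/
noncomputable def bakerData (h L : ℕ) (b : ι → ℤ) (B b₀ : ℤ)
    (c : Fin (h * L) × (ι → Fin L) × Fin L → ℤ) :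
    AuxData ι (Fin (h * L) × (ι → Fin L) × Fin L) where
  ν := Nat.lcmUpto h
  B := B
  P s := feldman h s.1
  γ s i := B * (s.2.1 i : ℕ) - b i * (s.2.2 : ℕ)
  e s := (s.2.2 : ℕ) * b₀
  c := c

theorem norm_bakerData_term_le {h L T K a : ℕ} (hh : 1 ≤ h) (hKh : K ≤ h) (hL : L = K ^ a)
    (hL1 : 1 ≤ L) {b : ι → ℤ} {B b₀ : ℤ} (hb : ∀ i, |(b i : ℝ)| ≤ Real.exp h)
    (hB : |(B : ℝ)| ≤ Real.exp h) (hb₀ : |(b₀ : ℝ)| ≤ Real.exp h)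
    (c : Fin (h * L) × (ι → Fin L) × Fin L → ℤ) {Y ρ : ℝ} (hY : 1 ≤ Y) (hρY : ρ + T + h ≤ h * Y)
    {τ : ι → ℕ} {σ : ℕ} (s : Fin (h * L) × (ι → Fin L) × Fin L) {z : ℂ}
    (hτ : ∀ i, τ i ≤ T) (hσ : σ ≤ T) (hz : ‖z‖ ≤ ρ) :
    ‖(bakerData h L b B b₀ c).term τ σ s z‖ ≤ Real.exp ((8 + a) * h) ^ T *
      (Real.exp 1 * Y) ^ (h * L) * Real.exp ((2 + a) * h) ^ (Fintype.card ι * T) := by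
  have hh1 : (1 : ℝ) ≤ h := by exact_mod_cast hh
  have hLe : (L : ℝ) ≤ Real.exp (a * h) := by
    rw [hL]; push_cast
    refine (pow_le_exp_mul _ (Nat.cast_nonneg _) _).trans (Real.exp_le_exp.2 ?_)
    have : (K : ℝ) ≤ h := by exact_mod_cast hKh
    gcongr
  have hL1' : (1 : ℝ) ≤ L := by exact_mod_cast hL1
  have h2e : (2 : ℝ) ≤ Real.exp h := by linarith [Real.add_one_le_exp (h : ℝ)]
  have hν := lcmUpto_le_exp h
  refine AuxData.norm_term_le _ (ρ := ρ) hτ hσ (Real.one_le_exp (by positivity))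
    (Real.one_le_exp (by positivity)) ?_ ?_ ?_ hz
  · simp only [bakerData]
    push_cast
    rw [abs_mul, abs_mul, abs_mul, Nat.abs_cast, Nat.abs_cast]
    calc _ ≤ Real.exp (6 * h) * Real.exp h + Real.exp (6 * h) * (L * Real.exp h) := by
          gcongr
          exact_mod_cast s.2.2.2.le
      _ ≤ Real.exp (6 * h) * (L * Real.exp h) + Real.exp (6 * h) * (L * Real.exp h) := by
          gcongr
          exact le_mul_of_one_le_left (Real.exp_pos _).le hL1'
      _ = 2 * (Real.exp (6 * h) * (L * Real.exp h)) := by ring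
      _ ≤ Real.exp h * (Real.exp (6 * h) * (Real.exp (a * h) * Real.exp h)) := by gcongr
      _ = _ := by
          simp only [← Real.exp_add]
          congr 1; ring
  · intro i
    simp only [bakerData]
    push_cast
    rw [← Real.norm_eq_abs]
    refine (norm_sub_le _ _).trans ?_
    simp only [Real.norm_eq_abs]
    rw [abs_mul, abs_mul, Nat.abs_cast, Nat.abs_cast]
    calc _ ≤ Real.exp h * L + Real.exp h * L := by
          gcongr
          exacts [by exact_mod_cast (s.2.1 i).2.le, hb i, by exact_mod_cast s.2.2.2.le]
      _ = 2 * (Real.exp h * L) := by ring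
      _ ≤ Real.exp h * (Real.exp h * Real.exp (a * h)) := by gcongr
      _ = _ := by
          simp only [← Real.exp_add]
          congr 1; ring
  · intro w hw
    exact norm_feldman_eval_le s.1.2 hY (by linarith)

theorem prod_prime_pow_injective {p : ι → ℕ} {q : ℕ} (hp : ∀ i, (p i).Prime) (hq : q.Prime)
    (hinj : Function.Injective p) (hne : ∀ i, p i ≠ q) :
    Function.Injective fun e : (ι → ℕ) × ℕ => (∏ i, p i ^ e.1 i) * q ^ e.2 := by
  classical
  have hP0 : ∀ e : ι → ℕ, ∏ i, p i ^ e i ≠ 0 := fun e =>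
    prod_ne_zero_iff.2 fun i _ => pow_ne_zero _ (hp i).ne_zero
  have hfac : ∀ (e : (ι → ℕ) × ℕ) (r : ℕ), ((∏ i, p i ^ e.1 i) * q ^ e.2).factorization r =
      (∑ i, e.1 i * (if p i = r then 1 else 0)) + e.2 * (if q = r then 1 else 0) := by
    intro e r
    rw [Nat.factorization_mul (hP0 _) (pow_ne_zero _ hq.ne_zero),
      Nat.factorization_prod fun i _ => pow_ne_zero _ (hp i).ne_zero]
    simp only [Nat.factorization_pow, hq.factorization, (hp _).factorization]
    simp [Finsupp.single_apply]
  intro e e' h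
  have hr : ∀ r, _ := fun r => congrArg (fun n : ℕ => n.factorization r) h
  simp only [hfac] at hr
  refine Prod.ext (funext fun i => ?_) ?_
  · simpa [hinj.eq_iff, (hne i).symm] using hr (p i)
  · simpa [hne] using hr q

theorem bakerData_coeffs_eq_zero [DecidableEq ι] {h L : ℕ} {b : ι → ℤ} {B b₀ : ℤ}
    {c : Fin (h * L) × (ι → Fin L) × Fin L → ℤ} {ω : Fin (h * L) × (ι → Fin L) × Fin L → ℂ}
    {A : (ι → Fin L) × Fin L → ℕ} (hA : ∀ s, Complex.exp (ω s) = A s.2)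
    (hinj : Function.Injective A) (hA0 : ∀ y, A y ≠ 0)
    (hvan : ∀ x : ℕ, x < h * L ^ (Fintype.card ι + 2) →
      (bakerData h L b B b₀ c).aux ω 0 0 x = 0) : c = 0 := by
  set Q : (ι → Fin L) × Fin L → ℂ[X] := fun y =>
    ∑ j : Fin (h * L), C ((c (j, y) : ℤ) : ℂ) * feldman h j with hQ
  have hQ0 : ∀ y, Q y = 0 := by
    refine exp_poly_eq_zero (h * L ^ (Fintype.card ι + 2)) (fun y => (A y : ℂ))
      (fun y y' hy => hinj (Nat.cast_injective hy)) ?_ (fun _ => h * L) ?_ Q ?_ ?_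
    · exact fun y => by exact_mod_cast hA0 y
    · simp; ring
    · intro y
      refine (degree_sum_le _ _).trans_lt ?_
      rw [Finset.sup_lt_iff (WithBot.bot_lt_coe _)]
      intro j _
      rw [← smul_eq_C_mul]
      refine (degree_smul_le _ _).trans_lt ?_
      rw [degree_feldman]
      exact_mod_cast j.2
    · intro x hx
      refine Eq.trans ?_ (hvan x hx)
      rw [AuxData.aux]
      refine Eq.trans ?_ (Fintype.sum_prod_type_right _).symm
      refine Finset.sum_congr rfl fun y _ => ?_
      rw [hQ, eval_finsetSum, Finset.sum_mul]
      refine Finset.sum_congr rfl fun j _ => ?_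
      have : Complex.exp (ω (j, y) * x) = (A y : ℂ) ^ x := by
        rw [← hA (j, y), ← Complex.exp_nat_mul, mul_comm]
      rw [this]
      simp [AuxData.term, bakerData]
      ring
  funext s
  have := feldman_sum_eq_zero (hQ0 s.2) s.1
  exact_mod_cast this

end Construction

end

theorem sample_radius_le {h K J J₀ b : ℕ} (hh : 1 ≤ h) (hK : 1 ≤ K) (hJ : J ≤ J₀)
    (hJK : J₀ + 1 ≤ K) :
    ((h * K ^ J : ℕ) : ℝ) * (K ^ 2 + 1) + ((J₀ + 1) * K ^ b : ℕ) + h ≤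
      h * Real.exp ((J₀ + b + 4 : ℕ) * K) := by
  have hK1 : (1 : ℝ) ≤ K := by exact_mod_cast hK
  have hh1 : (1 : ℝ) ≤ h := by exact_mod_cast hh
  have hJK' : (J₀ : ℝ) + 1 ≤ K := by exact_mod_cast hJK
  have h4 : (4 : ℝ) ≤ Real.exp (2 * K) := by
    have h2 : (2 : ℝ) ≤ Real.exp K := by linarith [Real.add_one_le_exp (K : ℝ)]
    rw [two_mul, Real.exp_add]
    nlinarith
  have hm : (K : ℝ) ^ (J₀ + b + 2) ≤ Real.exp ((J₀ + b + 2 : ℕ) * K) :=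
    pow_le_exp_mul _ (by linarith) _
  set M : ℝ := (K : ℝ) ^ (J₀ + b + 2) with hM
  have hM1 : 1 ≤ M := one_le_pow₀ hK1
  have h1 : (K : ℝ) ^ J * (K ^ 2 + 1) ≤ 2 * M := by
    calc (K : ℝ) ^ J * (K ^ 2 + 1) ≤ K ^ J * (K ^ 2 + K ^ 2) := by
          gcongr; exact one_le_pow₀ hK1
      _ = 2 * (K : ℝ) ^ (J + 2) := by ring
      _ ≤ 2 * M := by
          gcongr
          exact pow_le_pow_right₀ hK1 (by omega)
  have h2 : ((J₀ : ℝ) + 1) * K ^ b ≤ M := by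
    calc ((J₀ : ℝ) + 1) * K ^ b ≤ K * K ^ b := by gcongr
      _ = (K : ℝ) ^ (b + 1) := by ring
      _ ≤ M := pow_le_pow_right₀ hK1 (by omega)
  push_cast
  calc (h : ℝ) * K ^ J * (K ^ 2 + 1) + (J₀ + 1) * K ^ b + h
      = h * (K ^ J * (K ^ 2 + 1)) + 1 * ((J₀ + 1) * K ^ b) + h := by ring
    _ ≤ h * (2 * M) + h * M + h * M := by
        gcongr
        exact le_mul_of_one_le_right (by linarith) hM1
    _ = h * (4 * M) := by ring
    _ ≤ h * (Real.exp (2 * K) * Real.exp ((J₀ + b + 2 : ℕ) * K)) := by gcongr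
    _ = _ := by
        rw [← Real.exp_add]
        congr 2; push_cast; ring

theorem term_bound_le_exp {h K n a J₀ Q : ℕ} (hK : 1 ≤ K) :
    Real.exp ((8 + a) * h) ^ ((J₀ + 1) * K ^ (a + 2)) *
      (Real.exp 1 * Real.exp (Q * K)) ^ (h * K ^ a) *
      Real.exp ((2 + a) * h) ^ (n * ((J₀ + 1) * K ^ (a + 2))) ≤
    Real.exp (((8 + a) * (J₀ + 1) + (1 + Q) + (2 + a) * n * (J₀ + 1)) * (h * K ^ (a + 2))) := by
  have hK1 : (1 : ℝ) ≤ K := by exact_mod_cast hK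
  simp only [← Real.exp_add, ← Real.exp_nat_mul]
  refine Real.exp_le_exp.2 ?_
  have : (h : ℝ) * K ^ a * (1 + Q * K) ≤ (1 + Q) * (h * K ^ (a + 2)) := by
    calc (h : ℝ) * K ^ a * (1 + Q * K) ≤ h * K ^ a * (K ^ 2 + Q * K ^ 2) := by
          gcongr
          · exact one_le_pow₀ hK1
          · exact le_self_pow₀ hK1 two_ne_zero
      _ = _ := by ring
  push_cast
  linarith

theorem two_mul_conditions_le_unknowns {h K n : ℕ}
    (hK : 2 * ((2 * n + 3) * (n + 2) + 1) ^ (n + 1) ≤ K) :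
    2 * (h * (((2 * n + 3) * (n + 2) + 1) * K ^ (2 * n + 3 + 2)) ^ (n + 1)) ≤
      h * K ^ ((2 * n + 3) * (n + 2)) := by
  have : (2 * n + 3) * (n + 2) = (2 * n + 3 + 2) * (n + 1) + 1 := by ring
  calc _ = h * (2 * ((2 * n + 3) * (n + 2) + 1) ^ (n + 1) * K ^ ((2 * n + 3 + 2) * (n + 1))) := by
        rw [mul_pow, pow_mul]; ring
    _ ≤ h * (K * K ^ ((2 * n + 3 + 2) * (n + 1))) := by gcongr
    _ = _ := by rw [this, pow_succ']

theorem exists_linear_form_lower_bound {ι : Type*} [Fintype ι] [DecidableEq ι] {p : ι → ℕ} {q : ℕ}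
    (hp : ∀ i, (p i).Prime) (hq : q.Prime) (hinj : Function.Injective p) (hne : ∀ i, p i ≠ q) :
    ∃ C : ℝ, 0 ≤ C ∧ ∃ h₀ : ℕ, ∀ h ≥ h₀, ∀ (b : ι → ℤ) (B b₀ : ℤ), (∀ i, |(b i : ℝ)| ≤ Real.exp h) →
      |(B : ℝ)| ≤ Real.exp h → |(b₀ : ℝ)| ≤ Real.exp h → B ≠ 0 →
      Real.exp (-C * h) ≤ |b₀ + ∑ i, b i * Real.log (p i) + B * Real.log q| := by
  obtain ⟨n, hn⟩ : ∃ n, n = Fintype.card ι := ⟨_, rfl⟩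
  obtain ⟨a, ha⟩ : ∃ a, a = 2 * n + 3 := ⟨_, rfl⟩
  obtain ⟨J₀, hJ₀⟩ : ∃ J₀, J₀ = a * (n + 2) := ⟨_, rfl⟩
  obtain ⟨Q, hQ⟩ : ∃ Q, Q = J₀ + (a + 2) + 4 := ⟨_, rfl⟩
  have hlogp : ∀ i, 0 ≤ Real.log (p i) := fun i => Real.log_natCast_nonneg _
  have hlogq : 0 ≤ Real.log q := Real.log_natCast_nonneg _
  have hsum0 : 0 ≤ ∑ i, Real.log (p i) := Finset.sum_nonneg fun i _ => hlogp i
  set Λ₁ : ℝ := ∑ i, Real.log (p i) + Real.log q + 1 with hΛ₁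
  have hΛ₁0 : 0 ≤ Λ₁ := by positivity
  set x₁ : ℝ := (8 + a) * (J₀ + 1) + (1 + Q) + (2 + a) * n * (J₀ + 1) with hx₁
  have hx₁0 : 0 ≤ x₁ := by positivity
  set c₁ : ℝ := 2 * (1 + J₀) + 2 * x₁ + 3 * Λ₁ with hc₁
  have hc₁0 : 0 ≤ c₁ := by positivity
  obtain ⟨K, hK1, hK2, hK3⟩ : ∃ K : ℕ, Real.exp (c₁ + 2) ≤ K ∧ 2 * (J₀ + 1) ^ (n + 1) ≤ K ∧
      J₀ + 1 ≤ K := by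
    refine ⟨⌈Real.exp (c₁ + 2)⌉₊ + 2 * (J₀ + 1) ^ (n + 1) + (J₀ + 1), ?_, by omega, by omega⟩
    push_cast
    have := Nat.le_ceil (Real.exp (c₁ + 2))
    have h2 : (0 : ℝ) ≤ 2 * (J₀ + 1) ^ (n + 1) + (J₀ + 1) := by positivity
    linarith
  have hK : 1 ≤ K := by omega
  obtain ⟨C, hC0, hC⟩ := exists_smallness_constant a J₀ (K := K) (c₁ := c₁)
    (A := 1 + ∑ i, ‖((Real.log (p i) : ℝ) : ℂ)‖) hc₁0
    (add_nonneg zero_le_one (Finset.sum_nonneg fun i _ => norm_nonneg _)) hK1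
  refine ⟨C, hC0, K, fun h hKh b B b₀ hb hB hb₀ hB0 => ?_⟩
  by_contra! hlt
  have hh : 1 ≤ h := hK.trans hKh
  set Λ : ℝ := b₀ + ∑ i, b i * Real.log (p i) + B * Real.log q with hΛ
  have hΛle1 : |Λ| ≤ 1 := hlt.le.trans (Real.exp_le_one_iff.2 (by
    have : 0 ≤ C * h := by positivity
    linarith))
  obtain ⟨L, hL⟩ : ∃ L, L = K ^ a := ⟨_, rfl⟩
  have hL1 : 1 ≤ L := hL ▸ Nat.one_le_pow _ _ hK
  obtain ⟨T', hT'⟩ : ∃ T', T' = K ^ (a + 2) := ⟨_, rfl⟩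
  have hT'1 : 1 ≤ T' := hT' ▸ Nat.one_le_pow _ _ hK
  set S := Fin (h * L) × (ι → Fin L) × Fin L with hS
  have hcardS : Fintype.card S = h * K ^ J₀ := by
    simp only [hS, Fintype.card_prod, Fintype.card_fin, Fintype.card_pi, Finset.prod_const,
      Finset.card_univ, ← hn, hJ₀, hL, pow_mul]
    ring
  set A : (ι → Fin L) × Fin L → ℕ := fun y => (∏ i, p i ^ (y.1 i : ℕ)) * q ^ (y.2 : ℕ) with hA
  have hAinj : Function.Injective A := by
    intro y y' hy
    have := prod_prime_pow_injective hp hq hinj hne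
      (a₁ := (fun i => (y.1 i : ℕ), (y.2 : ℕ))) (a₂ := (fun i => (y'.1 i : ℕ), (y'.2 : ℕ))) hy
    simp only [Prod.mk.injEq, funext_iff] at this
    exact Prod.ext (funext fun i => Fin.ext (this.1 i)) (Fin.ext this.2)
  have hA0 : ∀ y, A y ≠ 0 := fun y => mul_ne_zero
    (Finset.prod_ne_zero_iff.2 fun i _ => pow_ne_zero _ (hp i).ne_zero) (pow_ne_zero _ hq.ne_zero)
  set ωr : S → ℝ := fun s => ∑ i, (s.2.1 i : ℕ) * Real.log (p i) + (s.2.2 : ℕ) * Real.log q with hωr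
  set ω : S → ℂ := fun s => (ωr s : ℝ) with hω
  set ω' : S → ℂ := fun s => (ωr s - (s.2.2 : ℕ) * Λ / B : ℝ) with hω'
  have hexp : ∀ s, Complex.exp (ω s) = A s.2 := by
    intro s
    have : Real.exp (ωr s) = A s.2 := by
      simp only [hωr, hA, Real.exp_add, Real.exp_sum, Real.exp_nat_mul]
      push_cast
      rw [Real.exp_log (by exact_mod_cast hq.pos)]
      congr 1
      exact Finset.prod_congr rfl fun i _ => by rw [Real.exp_log (by exact_mod_cast (hp i).pos)]
    simp only [hω]
    rw [← Complex.ofReal_exp, this]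
    simp
  have hLK : (L : ℝ) = K ^ a := by rw [hL]; push_cast; rfl
  have hωbound : ∀ s, |ωr s| ≤ L * (∑ i, Real.log (p i) + Real.log q) := by
    intro s
    have h1 : ∀ j : Fin L, ((j : ℕ) : ℝ) ≤ L := fun j => by exact_mod_cast j.2.le
    have h0 : 0 ≤ ωr s := add_nonneg (Finset.sum_nonneg fun i _ =>
      mul_nonneg (Nat.cast_nonneg _) (hlogp i)) (mul_nonneg (Nat.cast_nonneg _) hlogq)
    rw [abs_of_nonneg h0, mul_add, Finset.mul_sum]
    exact add_le_add (Finset.sum_le_sum fun i _ => mul_le_mul_of_nonneg_right (h1 _) (hlogp i))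
      (mul_le_mul_of_nonneg_right (h1 _) hlogq)
  have hdiff : ∀ s : S, |(s.2.2 : ℕ) * Λ / B| ≤ L * |Λ| := by
    intro s
    have hB1 : (1 : ℝ) ≤ |(B : ℝ)| := by exact_mod_cast Int.one_le_abs hB0
    rw [abs_div, abs_mul, Nat.abs_cast]
    refine (div_le_self (by positivity) hB1).trans ?_
    gcongr
    exact s.2.2.2.le
  have hL0 : (0 : ℝ) ≤ L := Nat.cast_nonneg _
  have hΩ : ∀ s, ‖ω s‖ ≤ K ^ a * Λ₁ := by
    intro s
    simp only [hω, Complex.norm_real, Real.norm_eq_abs]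
    refine (hωbound s).trans ?_
    rw [hΛ₁, hLK]
    exact mul_le_mul_of_nonneg_left (by linarith) (by positivity)
  have hΩ' : ∀ s, ‖ω' s‖ ≤ K ^ a * Λ₁ := by
    intro s
    simp only [hω', Complex.norm_real]
    refine (norm_sub_le _ _).trans ?_
    simp only [Real.norm_eq_abs]
    have h1 : L * |Λ| ≤ L * 1 := by gcongr
    have := hωbound s
    have := hdiff s
    rw [hΛ₁, ← hLK]
    linarith
  set ε : ℝ := K ^ a * Real.exp (-C * h) with hε
  have hε0 : 0 ≤ ε := by positivity
  have hωω' : ∀ s, ‖ω' s - ω s‖ ≤ ε := by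
    intro s
    simp only [hω', hω]
    rw [← Complex.ofReal_sub, Complex.norm_real, Real.norm_eq_abs, sub_sub_cancel_left, abs_neg]
    refine (hdiff s).trans ?_
    rw [hε, ← hLK]
    gcongr
  set T₀ : ℕ := (J₀ + 1) * T' with hT₀
  set Y : ℝ := Real.exp (Q * K) with hY
  have hY1 : 1 ≤ Y := Real.one_le_exp (by positivity)
  set X : ℝ := Real.exp ((8 + a) * h) ^ T₀ * (Real.exp 1 * Y) ^ (h * L) *
    Real.exp ((2 + a) * h) ^ (Fintype.card ι * T₀) with hX
  have hX1 : 1 ≤ X := by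
    refine one_le_mul_of_one_le_of_one_le (one_le_mul_of_one_le_of_one_le ?_ ?_) ?_
    · exact one_le_pow₀ (Real.one_le_exp (by positivity))
    · exact one_le_pow₀ (one_le_mul_of_one_le_of_one_le (Real.one_le_exp zero_le_one) hY1)
    · exact one_le_pow₀ (Real.one_le_exp (by positivity))
  have hXle : X ≤ Real.exp (x₁ * (h * K ^ (a + 2))) := by
    rw [hX, hT₀, hT', hL, ← hn]
    exact term_bound_le_exp hK
  have hterm : ∀ (c : S → ℤ) (J : ℕ), J ≤ J₀ → ∀ τ : ι → ℕ, ∀ σ s, ∀ z : ℂ, (∀ i, τ i ≤ T₀) →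
      σ ≤ T₀ → ‖z‖ ≤ (h * K ^ J : ℕ) * (K ^ 2 + 1) →
      ‖(bakerData h L b B b₀ c).term τ σ s z‖ ≤ X := by
    intro c J hJ τ σ s z hτ hσ hz
    refine norm_bakerData_term_le hh hKh hL hL1 hb hB hb₀ c hY1 ?_ s hτ hσ hz
    have := sample_radius_le (b := a + 2) hh hK hJ hK3
    rw [← hQ, ← hT', ← hT₀] at this
    exact this
  have hν : (Nat.lcmUpto h : ℤ) ≠ 0 := by exact_mod_cast Nat.lcmUpto_ne_zero h
  have hP : ∀ s : S, feldman h s.1 ∈ integralSubring (Nat.lcmUpto h : ℤ) := fun s =>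
    feldman_mem _ _ _ hh fun j h1 h2 => dvd_lcmUpto h1 h2
  obtain ⟨c, hc0, hcb, hvan⟩ := (bakerData h L b B b₀ 0).exists_vanishing_coeffs
    (A := fun s => A s.2) (T := T₀) (R := h) (X := X) (Ω := K ^ a * Λ₁) hexp hP (by positivity)
    (by omega) hX1 (by positivity) (by
      intro τ σ s x hx hτ hσ
      refine hterm 0 0 (Nat.zero_le _) τ σ s x (fun i => (hτ i).le) hσ.le ?_
      rw [Complex.norm_natCast, pow_zero, mul_one]
      have : (x : ℝ) ≤ h := by exact_mod_cast hx.le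
      have : (0 : ℝ) ≤ h * K ^ 2 := by positivity
      linarith) hΩ (by
      have := two_mul_conditions_le_unknowns (h := h) (K := K) (n := n) (by rw [← ha, ← hJ₀]; exact hK2)
      rw [hcardS, ← hn, hT₀, hT']
      rwa [← ha, ← hJ₀] at this)
  refine hc0 (bakerData_coeffs_eq_zero (b := b) (B := B) (b₀ := b₀) hexp hAinj hA0 ?_)
  have hmain : ∀ J ≤ J₀, ∀ τ : ι → ℕ, ∀ σ, (∀ i, τ i < (J₀ + 1 - J) * T') →
      σ < (J₀ + 1 - J) * T' → ∀ x < h * K ^ J,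
      (bakerData h L b B b₀ c).aux ω τ σ (x : ℕ) = 0 := by
    intro J
    induction J with
    | zero =>
      intro _ τ σ hτ hσ x hx
      exact hvan τ σ hτ hσ x (by simpa using hx)
    | succ J ih =>
      intro hJ τ σ hτ hσ x hx
      have hJ' : J ≤ J₀ := by omega
      have hTT : (J₀ + 1 - (J + 1)) * T' + T' ≤ (J₀ + 1 - J) * T' := by
        rw [← Nat.succ_mul]
        exact Nat.mul_le_mul_right _ (by omega)
      have hTT₀ : (J₀ + 1 - J) * T' ≤ T₀ := Nat.mul_le_mul_right _ (Nat.sub_le _ _)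
      obtain ⟨hε1, hsmall⟩ := hC h J (h * K ^ J) T' hh hJ' rfl hT' ε
        (Real.exp (c₁ * ((h * K ^ J : ℕ) * T'))) _ hε0 le_rfl rfl rfl
      refine (bakerData h L b B b₀ c).vanishing_step (ω' := ω') (A := fun s => A s.2)
        (l := fun i => (Real.log (p i) : ℝ)) (R := h * K ^ J) (K := K)
        hν hB0 ?_ hexp hP hTT
        (Nat.mul_pos hh (Nat.pow_pos hK)) hT'1 hK (X := X) hcb ?_ hΩ hΩ' hωω' hε1 ?_ le_rfl
        hsmall (ih hJ') τ σ hτ hσ x (by rw [mul_assoc, ← pow_succ]; exact hx)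
      · intro s
        have hB' : (B : ℝ) ≠ 0 := by exact_mod_cast hB0
        have : (B : ℝ) * (ωr s - (s.2.2 : ℕ) * Λ / B) =
            ∑ i, ((B : ℝ) * (s.2.1 i : ℕ) - b i * (s.2.2 : ℕ)) * Real.log (p i) -
              (s.2.2 : ℕ) * b₀ := by
          rw [mul_sub, mul_div_cancel₀ _ hB']
          simp only [sub_mul, Finset.sum_sub_distrib, hωr, hΛ, mul_add, Finset.mul_sum]
          have h1 : ∀ i, (B : ℝ) * (s.2.1 i : ℕ) * Real.log (p i) =
            B * ((s.2.1 i : ℕ) * Real.log (p i)) := fun i => by ring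
          have h2 : ∀ i, (b i : ℝ) * (s.2.2 : ℕ) * Real.log (p i) =
            (s.2.2 : ℕ) * (b i * Real.log (p i)) := fun i => by ring
          simp only [h1, h2]
          ring
        simp only [bakerData, hω']
        exact_mod_cast congrArg (Complex.ofReal) this
      · intro τ σ s z hτ hσ hz
        exact hterm c J hJ' τ σ s z (fun i => ((hτ i).trans_le hTT₀).le) (hσ.trans_le hTT₀).le hz
      · have := total_bound_le (J₀ := J₀) (J := J) hh hK hKh hx₁0 hΛ₁0 hXle (by linarith)
        rw [hcardS, hT']
        push_cast at this ⊢
        exact this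
  intro x hx
  refine hmain J₀ le_rfl 0 0 (fun i => ?_) ?_ x ?_
  · simpa using Nat.pos_of_ne_zero (by omega)
  · simpa using Nat.pos_of_ne_zero (by omega)
  · rwa [hJ₀, pow_mul, ← hL, hn]

theorem exists_forall_lower_bound {d : ℕ} {p : Fin d → ℕ} (hp : ∀ i, (p i).Prime)
    (hmono : StrictMono p) :
    ∃ C : ℝ, 0 ≤ C ∧ ∃ h₀ : ℕ, ∀ h ≥ h₀, ∀ (m : Fin d → ℤ) (b₀ : ℤ), m ≠ 0 →
      (∀ i, |(m i : ℝ)| ≤ Real.exp h) → |(b₀ : ℝ)| ≤ Real.exp h →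
      Real.exp (-C * h) ≤ |∑ i, (m i : ℝ) * Real.log (p i) + b₀| := by
  have key := fun r : Fin d => exists_linear_form_lower_bound (ι := {j : Fin d // j ≠ r})
    (p := fun j => p j) (q := p r) (fun j => hp j) (hp r)
    (hmono.injective.comp Subtype.val_injective) (fun j => hmono.injective.ne j.2)
  choose C hC0 h₀ hC using key
  refine ⟨∑ r, C r, Finset.sum_nonneg fun r _ => hC0 r, ∑ r, h₀ r, ?_⟩
  intro h hh m b₀ hm hmb hb₀
  obtain ⟨r, hr⟩ := Function.ne_iff.1 hm
  have h1 := hC r h ((Finset.single_le_sum (fun _ _ => Nat.zero_le _) (mem_univ r)).trans hh)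
    (fun j => m j) (m r) b₀ (fun j => hmb j) (hmb r) hb₀ hr
  have h2 : (b₀ : ℝ) + ∑ j : {j : Fin d // j ≠ r}, (m j : ℝ) * Real.log (p j) +
      m r * Real.log (p r) = ∑ i, (m i : ℝ) * Real.log (p i) + b₀ := by
    rw [Fintype.sum_eq_add_sum_subtype_ne _ r]
    ring
  rw [h2] at h1
  refine le_trans (Real.exp_le_exp.2 ?_) h1
  have : C r ≤ ∑ r, C r := Finset.single_le_sum (fun i _ => hC0 i) (mem_univ r)
  gcongr

end BakerFeldman

/-- Baker's theorem consequence. For distinct primes `p₁ < … < p_d`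
there are `c, κ > 0` such that for every nonzero `m ∈ ℤ^d`, the distance from
`∑ m_j log p_j` to the nearest integer is at least `c / (max_j |m_j|)^κ`. -/
theorem baker_linear_forms_in_logs
    (d : ℕ) (p : Fin d → ℕ) (hp : ∀ i, (p i).Prime) (hmono : StrictMono p) :
    ∃ c > (0 : ℝ), ∃ κ > (0 : ℝ), ∀ m : Fin d → ℤ, m ≠ 0 →
      c / (((Finset.univ.sup fun i => (m i).natAbs : ℕ) : ℝ) ^ κ) ≤
        |(∑ i, (m i : ℝ) * Real.log (p i)) - round (∑ i, (m i : ℝ) * Real.log (p i))| := by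
  obtain ⟨C, hC0, h₀, hC⟩ := BakerFeldman.exists_forall_lower_bound hp hmono
  have hlogp : ∀ i, 0 ≤ Real.log (p i) := fun i => Real.log_natCast_nonneg _
  set Λ : ℝ := ∑ i, Real.log (p i) with hΛ
  have hΛ0 : 0 ≤ Λ := Finset.sum_nonneg fun i _ => hlogp i
  obtain ⟨k, hk⟩ : ∃ k : ℕ, Λ + 1 ≤ k := exists_nat_ge _
  refine ⟨Real.exp (-(C * (h₀ + k + 1))), Real.exp_pos _, C + 1, by positivity, fun m hm => ?_⟩
  set H : ℕ := Finset.univ.sup fun i => (m i).natAbs with hH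
  have hmH : ∀ i, |(m i : ℝ)| ≤ H := by
    intro i
    have h1 : (m i).natAbs ≤ H := Finset.le_sup (f := fun i => (m i).natAbs) (Finset.mem_univ i)
    rw [← Int.cast_abs, Int.abs_eq_natAbs]
    exact_mod_cast h1
  have hH1 : 1 ≤ H := by
    obtain ⟨r, hr⟩ := Function.ne_iff.1 hm
    have h1 : (m r).natAbs ≤ H := Finset.le_sup (f := fun i => (m i).natAbs) (Finset.mem_univ r)
    exact (Int.natAbs_pos.2 hr).trans_le h1
  have hH1' : (1 : ℝ) ≤ H := by exact_mod_cast hH1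
  have hH0 : (0 : ℝ) < H := by linarith
  set t : ℝ := ∑ i, (m i : ℝ) * Real.log (p i) with ht
  have htH : |t| ≤ H * Λ := by
    rw [ht, hΛ, Finset.mul_sum]
    refine (Finset.abs_sum_le_sum_abs _ _).trans (Finset.sum_le_sum fun i _ => ?_)
    rw [abs_mul, abs_of_nonneg (hlogp i)]
    exact mul_le_mul_of_nonneg_right (hmH i) (hlogp i)
  set h : ℕ := ⌈Real.log H⌉₊ + h₀ + k with hh
  have hlogH : 0 ≤ Real.log H := Real.log_nonneg hH1'
  have hh_le : (h : ℝ) ≤ Real.log H + (h₀ + k + 1) := by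
    have := (Nat.ceil_lt_add_one hlogH).le
    rw [hh]; push_cast
    linarith
  have hexp : (H : ℝ) * (Λ + 1) ≤ Real.exp h := by
    have h1 : Λ + 1 ≤ Real.exp k := hk.trans (BakerFeldman.self_le_exp _)
    have h2 : Real.log H + k ≤ h := by
      have := Nat.le_ceil (Real.log H)
      have h3 : (0 : ℝ) ≤ h₀ := Nat.cast_nonneg _
      rw [hh]; push_cast
      linarith
    calc (H : ℝ) * (Λ + 1) ≤ H * Real.exp k := by gcongr
      _ = Real.exp (Real.log H + k) := by rw [Real.exp_add, Real.exp_log hH0]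
      _ ≤ Real.exp h := Real.exp_le_exp.2 h2
  have hmain := hC h (by omega) m (-round t) hm (fun i => (hmH i).trans (by nlinarith)) (by
    have h1 := abs_sub_round t
    have h2 : |((-round t : ℤ) : ℝ)| ≤ |t| + |t - round t| := by
      push_cast
      rw [abs_neg]
      have := abs_sub_abs_le_abs_sub ((round t : ℤ) : ℝ) t
      rw [abs_sub_comm] at this
      linarith
    nlinarith)
  push_cast at hmain
  rw [← ht, ← sub_eq_add_neg] at hmain
  refine le_trans ?_ hmain
  rw [div_le_iff₀ (Real.rpow_pos_of_pos hH0 _), Real.rpow_def_of_pos hH0, ← Real.exp_add]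
  refine Real.exp_le_exp.2 ?_
  have := mul_le_mul_of_nonneg_left hh_le hC0
  linarith
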